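/- arXiv:2211.08763 — 2 statements merged into one kernel-verified Lean document; each statement's English description precedes it below -/
import Mathlib

section
/- Let α, β be positive reals with αβ = 1. Then √α·{(γ − log(2πα))/(2α) + ∑_{n=1}^∞ φ(nα)} = √β·{(γ − log(2πβ))/(2β) + ∑_{n=1}^∞ φ(nβ)}. -/
noncomputable section
open Complex MeasureTheory Set Filter Topology

/-- Digamma function `ψ = Γ'/Γ`. -/
def digam (x : ℝ) : ℝ := deriv Real.Gamma x / Real.Gamma x

/-- `φ(x) = ψ(x) + 1/(2x) - log x`. -/
def phi (x : ℝ) : ℝ := digam x + 1 / (2 * x) - Real.log x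

lemma log_upper {u : ℝ} (hu : 0 ≤ u) :
    Real.log (1 + u) ≤ u * (2 + u) / (2 * (1 + u)) := by
  have hmono : MonotoneOn (fun x : ℝ => x * (2 + x) / (2 * (1 + x)) - Real.log (1 + x)) (Ici 0) := by
    have hd : ∀ x : ℝ, 0 ≤ x → HasDerivAt
        (fun x : ℝ => x * (2 + x) / (2 * (1 + x)) - Real.log (1 + x))
        (x ^ 2 / (2 * (1 + x) ^ 2)) x := by
      intro x hx
      have h1 : (1 + x) ≠ 0 := by positivity
      have a1 : HasDerivAt (fun x : ℝ => x * (2 + x)) (1 * (2 + x) + x * 1) x :=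
        (hasDerivAt_id x).mul ((hasDerivAt_id x).const_add 2)
      have a2 : HasDerivAt (fun x : ℝ => 2 * (1 + x)) (2 * 1) x :=
        ((hasDerivAt_id x).const_add 1).const_mul 2
      have a3 : HasDerivAt (fun x : ℝ => Real.log (1 + x)) (1 / (1 + x)) x :=
        ((hasDerivAt_id x).const_add 1).log h1
      have := (a1.div a2 (by positivity)).sub a3
      refine this.congr_deriv ?_
      field_simp
      ring
    refine monotoneOn_of_deriv_nonneg (convex_Ici 0) ?_ ?_ ?_
    · intro x hx
      exact (hd x hx).continuousAt.continuousWithinAt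
    · intro x hx
      rw [interior_Ici] at hx
      exact (hd x (le_of_lt hx)).differentiableAt.differentiableWithinAt
    · intro x hx
      rw [interior_Ici] at hx
      rw [(hd x (le_of_lt hx)).deriv]
      positivity
  have := hmono (mem_Ici.2 le_rfl) (mem_Ici.2 hu) hu
  simp at this
  linarith

lemma diff_log_Gamma {x : ℝ} (hx : 0 < x) :
    HasDerivAt (Real.log ∘ Real.Gamma) (digam x) x := by
  have hd : DifferentiableAt ℝ Real.Gamma x := by
    apply Real.differentiableAt_Gamma
    intro m
    have : (0 : ℝ) ≤ m := Nat.cast_nonneg m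
    linarith
  exact hd.hasDerivAt.log (Real.Gamma_pos_of_pos hx).ne'

lemma digam_add_one {x : ℝ} (hx : 0 < x) : digam (x + 1) = digam x + 1 / x := by
  have h1 : HasDerivAt (fun y : ℝ => (Real.log ∘ Real.Gamma) (y + 1)) (digam (x + 1)) x := by
    have := (diff_log_Gamma (x := x + 1) (by linarith)).comp_add_const x 1
    exact this
  have h2 : HasDerivAt (fun y : ℝ => (Real.log ∘ Real.Gamma) y + Real.log y)
      (digam x + 1 / x) x := by
    have := (diff_log_Gamma hx).add (Real.hasDerivAt_log hx.ne')
    rw [one_div]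
    exact this
  refine (h1.congr_of_eventuallyEq ?_).unique h2 |>.symm ▸ rfl
  filter_upwards [lt_mem_nhds hx] with y hy
  have hG := Real.Gamma_pos_of_pos hy
  simp only [Function.comp]
  rw [Real.Gamma_add_one hy.ne', Real.log_mul hy.ne' hG.ne', add_comm]

lemma log_Gamma_slope {x : ℝ} (hx : 0 < x) :
    slope (Real.log ∘ Real.Gamma) x (x + 1) = Real.log x := by
  have hG := Real.Gamma_pos_of_pos hx
  rw [slope_def_field]
  simp only [Function.comp]
  rw [Real.Gamma_add_one hx.ne', Real.log_mul hx.ne' hG.ne']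
  field_simp
  ring

lemma digam_le {x : ℝ} (hx : 0 < x) : digam x ≤ Real.log x := by
  rw [← log_Gamma_slope hx]
  exact Real.convexOn_log_Gamma.le_slope_of_hasDerivAt (mem_Ioi.2 hx)
    (mem_Ioi.2 (by linarith)) (by linarith) (diff_log_Gamma hx)

lemma le_digam {x : ℝ} (hx : 0 < x) : Real.log x - 1 / x ≤ digam x := by
  have : Real.log x ≤ digam (x + 1) := by
    rw [← log_Gamma_slope hx]
    exact Real.convexOn_log_Gamma.slope_le_of_hasDerivAt (mem_Ioi.2 hx)
      (mem_Ioi.2 (by linarith)) (by linarith) (diff_log_Gamma (by linarith))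
  rw [digam_add_one hx] at this
  linarith

lemma tendsto_phi : Tendsto phi atTop (𝓝 0) := by
  have h : Tendsto (fun x : ℝ => 1 / (2 * x)) atTop (𝓝 0) := by
    have := (tendsto_inv_atTop_zero (𝕜 := ℝ)).const_mul (1 / 2)
    simp only [mul_zero] at this
    refine this.congr fun x => ?_
    rw [one_div, one_div, mul_inv]
  have h' : Tendsto (fun x : ℝ => - (1 / (2 * x))) atTop (𝓝 0) := by simpa using h.neg
  refine tendsto_of_tendsto_of_tendsto_of_le_of_le' h' h ?_ ?_
  · filter_upwards [eventually_gt_atTop 0] with x hx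
    have := le_digam hx
    have e : 1 / x = 1 / (2 * x) + 1 / (2 * x) := by field_simp; norm_num
    unfold phi
    linarith
  · filter_upwards [eventually_gt_atTop 0] with x hx
    have := digam_le hx
    unfold phi
    linarith

lemma phi_step {y : ℝ} (hy : 0 < y) :
    phi y ≤ phi (y + 1) ∧
      phi (y + 1) + 1 / (8 * (y + 1) ^ 2) ≤ phi y + 1 / (8 * y ^ 2) := by
  have hL : Real.log (y + 1) = Real.log y + Real.log (1 + 1 / y) := by
    rw [← Real.log_mul hy.ne' (by positivity)]
    congr 1
    field_simp
  have hu : 0 ≤ 1 / y := by positivity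
  have h1 := log_upper hu
  have h2 := Real.le_log_one_add_of_nonneg hu
  have e1 : 1 / y * (2 + 1 / y) / (2 * (1 + 1 / y)) = 1 / (2 * y) + 1 / (2 * (y + 1)) := by
    field_simp
    ring
  have e2 : 2 * (1 / y) / (1 / y + 2) = 2 / (2 * y + 1) := by
    field_simp
    ring
  have e3 : 1 / y = 1 / (2 * y) + 1 / (2 * y) := by field_simp; norm_num
  rw [e1] at h1
  rw [e2] at h2
  unfold phi
  rw [digam_add_one hy, hL]
  constructor
  · linarith
  · have key : 0 ≤ 2 / (2 * y + 1) - (1 / (2 * y) + 1 / (2 * (y + 1)))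
        + (1 / (8 * y ^ 2) - 1 / (8 * (y + 1) ^ 2)) := by
      have : 2 / (2 * y + 1) - (1 / (2 * y) + 1 / (2 * (y + 1)))
        + (1 / (8 * y ^ 2) - 1 / (8 * (y + 1) ^ 2))
        = 1 / (8 * y ^ 2 * (y + 1) ^ 2 * (2 * y + 1)) := by
        field_simp
        ring
      rw [this]
      positivity
    linarith

lemma phi_bounds {y : ℝ} (hy : 0 < y) : -(1 / (8 * y ^ 2)) ≤ phi y ∧ phi y ≤ 0 := by
  have hpos : ∀ k : ℕ, 0 < y + k := fun k => by positivity
  have hk : Tendsto (fun k : ℕ => y + (k : ℝ)) atTop atTop :=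
    tendsto_atTop_add_const_left _ _ tendsto_natCast_atTop_atTop
  have t1 : Tendsto (fun k : ℕ => phi (y + k)) atTop (𝓝 0) := tendsto_phi.comp hk
  have t2 : Tendsto (fun k : ℕ => phi (y + k) + 1 / (8 * (y + k) ^ 2)) atTop (𝓝 0) := by
    have h3 : Tendsto (fun k : ℕ => 1 / (8 * (y + (k : ℝ)) ^ 2)) atTop (𝓝 0) := by
      have := ((tendsto_inv_atTop_zero.comp hk).pow 2).const_mul (1 / 8)
      simp only [ne_eq, OfNat.ofNat_ne_zero, not_false_eq_true, zero_pow, mul_zero] at this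
      refine this.congr fun k => ?_
      have := (hpos k).ne'
      simp only [Function.comp]
      field_simp
    simpa using t1.add h3
  have m1 : Monotone (fun k : ℕ => phi (y + k)) := by
    refine monotone_nat_of_le_succ fun k => ?_
    have := (phi_step (hpos k)).1
    push_cast
    rwa [← add_assoc]
  have m2 : Antitone (fun k : ℕ => phi (y + k) + 1 / (8 * (y + k) ^ 2)) := by
    refine antitone_nat_of_succ_le fun k => ?_
    have := (phi_step (hpos k)).2
    push_cast
    rwa [← add_assoc]
  have b1 := m1.ge_of_tendsto t1 0
  have b2 := m2.le_of_tendsto t2 0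
  simp only [Nat.cast_zero, add_zero] at b1 b2
  exact ⟨by linarith, b1⟩

lemma summable_phi {α : ℝ} (hα : 0 < α) : Summable (fun n : ℕ => phi (((n : ℝ) + 1) * α)) := by
  have h : Summable (fun n : ℕ => 1 / (8 * α ^ 2) * (1 / ((n : ℝ) + 1) ^ 2)) := by
    apply Summable.mul_left
    have := (summable_nat_add_iff 1).2 (Real.summable_one_div_nat_pow.2 (one_lt_two))
    simpa using this
  refine Summable.of_norm_bounded h fun n => ?_
  have hp : 0 < ((n : ℝ) + 1) * α := by positivity
  obtain ⟨a, b⟩ := phi_bounds hp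
  rw [Real.norm_eq_abs, abs_of_nonpos b]
  have : 1 / (8 * α ^ 2) * (1 / ((n : ℝ) + 1) ^ 2) = 1 / (8 * (((n : ℝ) + 1) * α) ^ 2) := by
    field_simp
  linarith

/-- Telescoping comparison function. -/
def PP (α y : ℝ) : ℝ :=
  (y * Real.log y - y) / α + Real.log y / 2 + Real.log y / (2 * α)

lemma PP_step {α w : ℝ} (hα : 0 < α) (hw : 0 < w) :
    Real.log (w + α) + 1 / (2 * (w + α)) - (PP α (w + α) - PP α w) ≤ 0 ∧
    -((α ^ 2 / 4 + α / 2) / w ^ 2) ≤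
      Real.log (w + α) + 1 / (2 * (w + α)) - (PP α (w + α) - PP α w) := by
  have hL : Real.log (w + α) = Real.log w + Real.log (1 + α / w) := by
    rw [← Real.log_mul hw.ne' (by positivity)]
    congr 1
    field_simp
  have hu : 0 ≤ α / w := by positivity
  have h1 := log_upper hu
  have h2 := Real.le_log_one_add_of_nonneg hu
  have h3 : Real.log (1 + α / w) ≤ α / w := by
    have := Real.log_le_sub_one_of_pos (show 0 < 1 + α / w by positivity)
    linarith
  have h4 : α / (w + α) ≤ Real.log (1 + α / w) := by
    have := Real.one_sub_inv_le_log_of_pos (show 0 < 1 + α / w by positivity)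
    have e : 1 - (1 + α / w)⁻¹ = α / (w + α) := by field_simp; ring
    linarith
  unfold PP
  rw [hL]
  set L := Real.log (1 + α / w) with hLdef
  set l := Real.log w
  have id1 : l + L + 1 / (2 * (w + α)) - (((w + α) * (l + L) - (w + α)) / α + (l + L) / 2
      + (l + L) / (2 * α) - ((w * l - w) / α + l / 2 + l / (2 * α)))
      = (1 - (w / α + 1 / 2) * L) + (1 / (2 * (w + α)) - L / (2 * α)) := by
    field_simp
    ring
  rw [id1]
  have c0 : 0 ≤ w / α + 1 / 2 := by positivity
  have c1 := mul_le_mul_of_nonneg_left h1 c0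
  have c2 := mul_le_mul_of_nonneg_left h2 c0
  have e1 : (w / α + 1 / 2) * (2 * (α / w) / (α / w + 2)) = 1 := by
    field_simp
    ring
  have e2 : (w / α + 1 / 2) * (α / w * (2 + α / w) / (2 * (1 + α / w)))
      = 1 + α ^ 2 / (4 * w * (w + α)) := by
    field_simp
    ring
  have d0 : 0 ≤ 1 / (2 * α) := by positivity
  have d1 := mul_le_mul_of_nonneg_left h3 d0
  have d2 := mul_le_mul_of_nonneg_left h4 d0
  have e3 : 1 / (2 * α) * (α / w) = 1 / (2 * w) := by field_simp
  have e4 : 1 / (2 * α) * (α / (w + α)) = 1 / (2 * (w + α)) := by field_simp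
  have e5 : 1 / (2 * α) * L = L / (2 * α) := by ring
  rw [e1] at c2
  rw [e2] at c1
  rw [e3, e5] at d1
  rw [e4, e5] at d2
  constructor
  · linarith
  · have f1 : α ^ 2 / (4 * w * (w + α)) ≤ α ^ 2 / 4 / w ^ 2 := by
      rw [div_div]
      apply div_le_div_of_nonneg_left (by positivity) (by positivity)
      nlinarith [mul_pos hw hα]
    have f2 : 1 / (2 * w) - 1 / (2 * (w + α)) ≤ α / 2 / w ^ 2 := by
      have : 1 / (2 * w) - 1 / (2 * (w + α)) = α / (2 * w * (w + α)) := by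
        field_simp
        ring
      rw [this, div_div]
      apply div_le_div_of_nonneg_left (by positivity) (by positivity)
      nlinarith [mul_pos hw hα]
    rw [add_div]
    linarith

/-- The symmetric double sum. -/
def SS (α : ℝ) (N : ℕ) : ℝ :=
  ∑ n ∈ Finset.range N, ∑ m ∈ Finset.range N, 1 / (((n : ℝ) + 1) * α + ((m : ℝ) + 1))

lemma digam_inner_sum {x : ℝ} (hx : 0 < x) (M : ℕ) :
    ∑ m ∈ Finset.range M, 1 / (x + ((m : ℝ) + 1)) =
      digam (x + M) + 1 / (x + M) - digam x - 1 / x := by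
  induction M with
  | zero => simp
  | succ k ih =>
    rw [Finset.sum_range_succ, ih]
    have : 0 < x + (k : ℝ) := by positivity
    have h := digam_add_one this
    push_cast
    rw [← add_assoc, h]
    ring

lemma SS_symm {α β : ℝ} (hα : 0 < α) (hβ : 0 < β) (h : α * β = 1) (N : ℕ) :
    SS β N = α * SS α N := by
  unfold SS
  rw [Finset.sum_comm, Finset.mul_sum]
  refine Finset.sum_congr rfl fun n _ => ?_
  rw [Finset.mul_sum]
  refine Finset.sum_congr rfl fun m _ => ?_
  have hb : β = 1 / α := by field_simp; linarith
  subst hb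
  field_simp
  ring

lemma SS_eq {α : ℝ} (hα : 0 < α) (N : ℕ) :
    SS α N - (PP α (N * α + N) - PP α N) + ∑ n ∈ Finset.range N, phi (((n : ℝ) + 1) * α)
      + ∑ n ∈ Finset.range N, Real.log (((n : ℝ) + 1) * α)
      + ∑ n ∈ Finset.range N, 1 / (2 * (((n : ℝ) + 1) * α))
    = ∑ n ∈ Finset.range N,
      ((Real.log ((n * α + N) + α) + 1 / (2 * ((n * α + N) + α))
        - (PP α ((n * α + N) + α) - PP α (n * α + N))) + phi ((n * α + N) + α)) := by
  have hP : PP α (N * α + N) - PP α N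
      = ∑ n ∈ Finset.range N, (PP α ((n * α + N) + α) - PP α (n * α + N)) := by
    have := Finset.sum_range_sub (fun n : ℕ => PP α ((n : ℝ) * α + N)) N
    simp only [Nat.cast_zero, zero_mul, zero_add] at this
    rw [← this]
    refine Finset.sum_congr rfl fun n _ => ?_
    push_cast
    congr 2
    ring
  rw [hP]
  unfold SS
  rw [← Finset.sum_sub_distrib, ← Finset.sum_add_distrib, ← Finset.sum_add_distrib,
    ← Finset.sum_add_distrib]
  refine Finset.sum_congr rfl fun n _ => ?_
  have hx : 0 < ((n : ℝ) + 1) * α := by positivity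
  rw [digam_inner_sum hx]
  have e : ((n : ℝ) + 1) * α + N = (n * α + N) + α := by ring
  rw [e]
  have hy : 0 < ((n : ℝ) * α + N) + α := by positivity
  unfold phi
  have e1 : 1 / (((n : ℝ) + 1) * α) = 2 * (1 / (2 * (((n : ℝ) + 1) * α))) := by field_simp
  have e2 : 1 / ((n : ℝ) * α + N + α) = 2 * (1 / (2 * ((n : ℝ) * α + N + α))) := by field_simp
  rw [e1, e2]
  ring

lemma SS_tendsto {α : ℝ} (hα : 0 < α) :
    Tendsto (fun N : ℕ =>
      SS α N - (PP α (N * α + N) - PP α N) + ∑ n ∈ Finset.range N, phi (((n : ℝ) + 1) * α)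
      + ∑ n ∈ Finset.range N, Real.log (((n : ℝ) + 1) * α)
      + ∑ n ∈ Finset.range N, 1 / (2 * (((n : ℝ) + 1) * α))) atTop (𝓝 0) := by
  set C : ℝ := α ^ 2 / 4 + α / 2 + 1 / 8 with hC
  have hlow : Tendsto (fun N : ℕ => -(C / (N : ℝ))) atTop (𝓝 0) := by
    have := (tendsto_const_div_atTop_nhds_zero_nat C).neg
    simpa using this
  refine tendsto_of_tendsto_of_tendsto_of_le_of_le' hlow tendsto_const_nhds ?_ ?_
  · filter_upwards [eventually_gt_atTop 0] with N hN
    rw [SS_eq hα]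
    have hN' : (0 : ℝ) < N := by exact_mod_cast hN
    have : -(C / (N : ℝ)) = ∑ n ∈ Finset.range N, -(C / (N : ℝ) ^ 2) := by
      rw [Finset.sum_const, Finset.card_range, nsmul_eq_mul]
      field_simp
    rw [this]
    refine Finset.sum_le_sum fun n _ => ?_
    have hw : (N : ℝ) ≤ n * α + N := by
      have : (0 : ℝ) ≤ n * α := by positivity
      linarith
    have hw0 : (0 : ℝ) < n * α + N := by linarith
    have a := (PP_step hα hw0).2
    have b := (phi_bounds (show (0 : ℝ) < n * α + N + α by linarith)).1
    have c1 : (α ^ 2 / 4 + α / 2) / ((n : ℝ) * α + N) ^ 2 ≤ (α ^ 2 / 4 + α / 2) / (N : ℝ) ^ 2 := by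
      gcongr
    have c2 : 1 / (8 * ((n : ℝ) * α + N + α) ^ 2) ≤ 1 / 8 / (N : ℝ) ^ 2 := by
      rw [div_div]
      gcongr
      linarith
    have c3 : C / (N : ℝ) ^ 2 = (α ^ 2 / 4 + α / 2) / (N : ℝ) ^ 2 + 1 / 8 / (N : ℝ) ^ 2 := by
      rw [hC, add_div]
    linarith
  · filter_upwards [eventually_gt_atTop 0] with N hN
    rw [SS_eq hα]
    have hN' : (0 : ℝ) < N := by exact_mod_cast hN
    refine Finset.sum_nonpos fun n _ => ?_
    have hw0 : (0 : ℝ) < n * α + N := by positivity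
    have a := (PP_step hα hw0).1
    have b := (phi_bounds (show (0 : ℝ) < n * α + N + α by linarith)).2
    linarith

lemma stirling_log : Tendsto (fun N : ℕ => Real.log (N.factorial) - (N * Real.log N - N
    + Real.log N / 2)) atTop (𝓝 (Real.log (2 * Real.pi) / 2)) := by
  have h := Stirling.tendsto_stirlingSeq_sqrt_pi.log (by positivity)
  have h2 := h.add_const (Real.log 2 / 2)
  have e : Real.log √Real.pi + Real.log 2 / 2 = Real.log (2 * Real.pi) / 2 := by
    rw [Real.log_sqrt Real.pi_pos.le, Real.log_mul two_ne_zero Real.pi_ne_zero]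
    ring
  rw [e] at h2
  refine h2.congr' ?_
  filter_upwards [eventually_gt_atTop 0] with N hN
  have hN' : (0 : ℝ) < N := by exact_mod_cast hN
  rw [Stirling.log_stirlingSeq_formula, Real.log_mul two_ne_zero hN'.ne',
    Real.log_div hN'.ne' (Real.exp_pos 1).ne', Real.log_exp]
  ring

lemma sum_log {α : ℝ} (hα : 0 < α) (N : ℕ) :
    ∑ n ∈ Finset.range N, Real.log (((n : ℝ) + 1) * α)
      = Real.log (N.factorial) + N * Real.log α := by
  induction N with
  | zero => simp
  | succ k ih =>
    have hk : (0 : ℝ) < (k : ℝ) + 1 := by positivity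
    have hf : (0 : ℝ) < (k.factorial : ℝ) := by exact_mod_cast k.factorial_pos
    rw [Finset.sum_range_succ, ih, Nat.factorial_succ]
    push_cast
    rw [Real.log_mul hk.ne' hα.ne', Real.log_mul hk.ne' hf.ne']
    ring

lemma sum_harm {α : ℝ} (N : ℕ) :
    ∑ n ∈ Finset.range N, 1 / (2 * (((n : ℝ) + 1) * α)) = (harmonic N : ℝ) / (2 * α) := by
  rw [harmonic]
  push_cast
  rw [Finset.sum_div]
  refine Finset.sum_congr rfl fun n _ => ?_
  rw [one_div, mul_inv, mul_inv, div_eq_mul_inv, mul_inv]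
  ring

lemma main_tendsto {α : ℝ} (hα : 0 < α) :
    Tendsto (fun N : ℕ => SS α N - N * ((1 + 1 / α) * Real.log (1 + α) - Real.log α)
      + (1 / 2 + 1 / (2 * α)) * Real.log N) atTop
      (𝓝 ((1 / 2 + 1 / (2 * α)) * Real.log (1 + α) - Real.log (2 * Real.pi) / 2
        - Real.eulerMascheroniConstant / (2 * α) - ∑' n : ℕ, phi (((n : ℝ) + 1) * α))) := by
  have h1 := SS_tendsto hα
  have h2 := (summable_phi hα).hasSum.tendsto_sum_nat
  have h3 := stirling_log
  have h4 := Real.tendsto_harmonic_sub_log.div_const (2 * α)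
  have h := (((h1.sub h2).sub h3).sub h4).add_const ((1 / 2 + 1 / (2 * α)) * Real.log (1 + α))
  have e : ∀ A B C D : ℝ, 0 - A - B - C + D = D - B - C - A := by intros; ring
  rw [e] at h
  refine h.congr' ?_
  filter_upwards [eventually_gt_atTop 0] with N hN
  have hN' : (0 : ℝ) < N := by exact_mod_cast hN
  rw [sum_log hα, sum_harm]
  unfold PP
  have e1 : (N : ℝ) * α + N = N * (1 + α) := by ring
  rw [e1, Real.log_mul hN'.ne' (by positivity)]
  field_simp
  ring

/-- Ramanujan's modular relation for the digamma function (first equality of the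
formula on page 220 of the Lost Notebook). -/
theorem ramanujan_digamma_modular (α β : ℝ) (hα : 0 < α) (hβ : 0 < β) (hαβ : α * β = 1) :
    Real.sqrt α * ((Real.eulerMascheroniConstant - Real.log (2 * Real.pi * α)) / (2 * α)
        + ∑' n : ℕ+, phi (n * α))
  = Real.sqrt β * ((Real.eulerMascheroniConstant - Real.log (2 * Real.pi * β)) / (2 * β)
        + ∑' n : ℕ+, phi (n * β)) := by
  have hsum : ∀ a : ℝ, ∑' n : ℕ+, phi (n * a) = ∑' n : ℕ, phi (((n : ℝ) + 1) * a) := by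
    intro a
    have := tsum_pnat_eq_tsum_succ (f := fun n : ℕ => phi ((n : ℝ) * a))
    simpa using this
  rw [hsum, hsum]
  have ta := (main_tendsto hα).const_mul α
  have tb := main_tendsto hβ
  set A := ∑' n : ℕ, phi (((n : ℝ) + 1) * α)
  set B := ∑' n : ℕ, phi (((n : ℝ) + 1) * β)
  have hb : β = 1 / α := by field_simp; linarith
  have hlb : Real.log β = - Real.log α := by rw [hb, one_div, Real.log_inv]
  have hl1b : Real.log (1 + β) = Real.log (1 + α) - Real.log α := by
    rw [← Real.log_div (by positivity) hα.ne', hb]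
    congr 1
    field_simp
    ring
  have hi : 1 / β = α := by rw [hb]; field_simp
  have hi2 : 1 / (2 * β) = α / 2 := by rw [hb]; field_simp
  have heq := tendsto_nhds_unique ta (tb.congr fun N => by
    rw [SS_symm hα hβ hαβ, hl1b, hlb, hi, hi2]
    field_simp
    ring)
  have hpi : (0 : ℝ) < 2 * Real.pi := by positivity
  rw [Real.log_mul hpi.ne' hα.ne', Real.log_mul hpi.ne' hβ.ne', hlb]
  have hd : Real.eulerMascheroniConstant / (2 * β) = Real.eulerMascheroniConstant * (α / 2) := by
    rw [← hi2]; ring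
  rw [hl1b, hi2, hd] at heq
  have hsq : √α = α * √β := by
    rw [hb, one_div, Real.sqrt_inv]
    have := Real.mul_self_sqrt hα.le
    have h0 : √α ≠ 0 := (Real.sqrt_pos.2 hα).ne'
    field_simp
    nlinarith
  have hd2 : ∀ x : ℝ, x / (2 * β) = x * (α / 2) := by
    intro x
    rw [← hi2]; ring
  rw [hsq, hd2]
  have h5 : α * ((Real.eulerMascheroniConstant - (Real.log (2 * Real.pi) + Real.log α)) / (2 * α) + A)
      = (Real.eulerMascheroniConstant - (Real.log (2 * Real.pi) + -Real.log α)) * (α / 2) + B := by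
    field_simp at heq ⊢
    linarith
  rw [← h5]
  ring
end
end

section
/- Let w ∈ ℂ∖{0}, let z ∈ ℂ with −1 < Re(z) < 1 and z ≠ 0, and let α, β be positive reals with αβ = 1. Suppose F, G : ℂ × (0,∞) → ℂ are such that for each x > 0, s ↦ F(s,x) and s ↦ G(s,x) are holomorphic on {s : Re(s) > −1, s ≠ 1} and satisfy F(s,x) = ζ_w(s, x+1) and G(s,x) = ζ_{iw}(s, x+1) for Re(s) > 1. Define φ_w(z,x) := F(z+1, x) + A_w(z)x^{−z−1}/2 − A_{iw}(−z)x^{−z}/z and φ_{iw}(z,x) := G(z+1, x) + A_{iw}(z)x^{−z−1}/2 − A_w(−z)x^{−z}/z. Then α^{(z+1)/2}·(∑_{m=1}^∞ φ_w(z, mα) − ζ(z+1)A_w(z)/(2α^{z+1}) − ζ(z)A_w(−z)/(αz)) = β^{(z+1)/2}·(∑_{m=1}^∞ φ_{iw}(z, mβ) − ζ(z+1)A_{iw}(z)/(2β^{z+1}) − ζ(z)A_{iw}(−z)/(βz)). -/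
noncomputable section
open Complex MeasureTheory Set Filter Topology

/-- Pochhammer symbol `(a)_n`. -/
def poch (a : ℂ) (n : ℕ) : ℂ := (ascPochhammer ℂ n).eval a

/-- Confluent hypergeometric function `₁F₁(a; c; z)`. -/
def oneF1 (a c z : ℂ) : ℂ := ∑' n : ℕ, poch a n / poch c n * z ^ n / (n.factorial : ℂ)

/-- Complex error function, defined by integrating along the segment from `0` to `w`. -/
def cerf (w : ℂ) : ℂ :=
  (2 / (Real.sqrt Real.pi : ℂ)) * ∫ t in (0:ℝ)..1, w * Complex.exp (-(t * w) ^ 2)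

/-- Complex imaginary error function. -/
def cerfi (w : ℂ) : ℂ :=
  (2 / (Real.sqrt Real.pi : ℂ)) * ∫ t in (0:ℝ)..1, w * Complex.exp ((t * w) ^ 2)

/-- `A_w(z) = (√π/w) erf(w/2) ₁F₁(1 + z/2; 3/2; w²/4)`. -/
def Afun (w z : ℂ) : ℂ :=
  ((Real.sqrt Real.pi : ℂ) / w) * cerf (w / 2) * oneF1 (1 + z / 2) (3/2) (w ^ 2 / 4)

/-- The generalized Hurwitz zeta function `ζ_w(s, a)` (for `Re(s) > 1`, `a > 0`). -/
def zetaW (w s : ℂ) (a : ℝ) : ℂ :=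
  (4 / (w ^ 2 * (Real.sqrt Real.pi : ℂ) * Complex.Gamma ((s + 1) / 2))) *
    ∑' n : ℕ+, ∫ u in Ioi (0:ℝ), ∫ v in Ioi (0:ℝ),
      ((u * v : ℝ) : ℂ) ^ (s - 1) * Complex.exp (-((u:ℂ) ^ 2 + (v:ℂ) ^ 2)) *
        Complex.sin (w * v) * Complex.sinh (w * u) /
        (((n:ℂ) ^ 2 * (u:ℂ) ^ 2 + ((a:ℂ) - 1) ^ 2 * (v:ℂ) ^ 2)) ^ (s / 2)



lemma preconn_halfplane (S : Set ℂ) (hS : S.Countable) :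
    IsPreconnected ({s : ℂ | 0 < s.re} \ S) := by
  let Φ : ℂ → ℂ := fun p => ⟨Real.exp p.re, p.im⟩
  have hΦ : Continuous Φ := by
    have : Φ = fun p : ℂ => ((Real.exp p.re : ℝ) : ℂ) + (p.im : ℂ) * I := by
      funext p
      apply Complex.ext <;> simp [Φ, Complex.exp_ofReal_re]
    rw [this]; fun_prop
  have hinj : Function.Injective Φ := by
    intro a b h
    have h1 := congrArg Complex.re h
    have h2 := congrArg Complex.im h
    simp only [Φ] at h1 h2
    exact Complex.ext (Real.exp_injective h1) h2
  have hc : (Φ ⁻¹' S).Countable := hS.preimage hinj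
  have := (hc.isConnected_compl_of_one_lt_rank (by simp)).2.image Φ hΦ.continuousOn
  convert this using 1
  ext s
  simp only [Set.mem_sdiff, mem_ofPred_eq, mem_image, mem_compl_iff, mem_preimage]
  constructor
  · rintro ⟨h1, h2⟩
    have : Φ ⟨Real.log s.re, s.im⟩ = s := by
      apply Complex.ext <;> simp [Φ, Real.exp_log h1]
    exact ⟨_, by rwa [this], this⟩
  · rintro ⟨p, hp, rfl⟩
    exact ⟨Real.exp_pos _, hp⟩

lemma eqOn_halfplane (S : Set ℂ) (hS : S.Finite) (f g : ℂ → ℂ) (c : ℝ) (hc : 0 ≤ c)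
    (hf : DifferentiableOn ℂ f ({s : ℂ | 0 < s.re} \ S))
    (hg : DifferentiableOn ℂ g ({s : ℂ | 0 < s.re} \ S))
    (h : ∀ s : ℂ, c < s.re → s ∉ S → f s = g s) :
    ∀ s : ℂ, 0 < s.re → s ∉ S → f s = g s := by
  have hop : IsOpen ({s : ℂ | 0 < s.re} \ S) :=
    (isOpen_lt continuous_const Complex.continuous_re).sdiff hS.isClosed
  have hop2 : IsOpen ({s : ℂ | c < s.re} \ S) :=
    (isOpen_lt continuous_const Complex.continuous_re).sdiff hS.isClosed
  obtain ⟨s0, hs0⟩ : ({s : ℂ | c < s.re} \ S).Nonempty := by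
    have : ({s : ℂ | c < s.re}).Infinite := by
      have : Set.InjOn (fun n : ℕ => ((c + 1 + n : ℝ) : ℂ)) univ := by
        intro a _ b _ h
        have : (c + 1 + a : ℝ) = c + 1 + b := Complex.ofReal_injective h
        have : (a:ℝ) = b := by linarith
        exact_mod_cast this
      refine Set.infinite_of_injOn_mapsTo this ?_ Set.infinite_univ
      intro n _
      simp only [mem_ofPred_eq, ofReal_re]
      have : (0:ℝ) ≤ n := by positivity
      linarith
    exact (this.sdiff hS).nonempty
  have := (hf.analyticOnNhd hop).eqOn_of_preconnected_of_eventuallyEq (hg.analyticOnNhd hop)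
    (preconn_halfplane S hS.countable) (z₀ := s0) ⟨lt_of_le_of_lt hc hs0.1, hs0.2⟩
    (by filter_upwards [hop2.mem_nhds hs0] with s hs using h s hs.1 hs.2)
  intro s h1 h2
  exact this ⟨h1, h2⟩

lemma differentiableOn_integral_param {X : Type*} [MeasurableSpace X] (μ : Measure X)
    (U : Set ℂ) (hU : IsOpen U) (f : ℂ → X → ℂ)
    (hm : ∀ s ∈ U, AEStronglyMeasurable (f s) μ)
    (hd : ∀ᵐ x ∂μ, DifferentiableOn ℂ (fun s => f s x) U)
    (hb : ∀ s₀ ∈ U, ∃ r > 0, ∃ b : X → ℝ, Integrable b μ ∧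
      ∀ᵐ x ∂μ, ∀ s ∈ Metric.ball s₀ r, ‖f s x‖ ≤ b x) :
    DifferentiableOn ℂ (fun s => ∫ x, f s x ∂μ) U := by
  intro s₀ hs₀
  obtain ⟨r₁, hr₁, b, hbi, hbb⟩ := hb s₀ hs₀
  obtain ⟨r₂, hr₂, hball⟩ := Metric.isOpen_iff.1 hU s₀ hs₀
  set r := min r₁ r₂ with hr
  have hrpos : 0 < r := lt_min hr₁ hr₂
  have hsub1 : Metric.ball s₀ r ⊆ Metric.ball s₀ r₁ := Metric.ball_subset_ball (min_le_left _ _)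
  have hsub2 : Metric.ball s₀ r ⊆ U := (Metric.ball_subset_ball (min_le_right _ _)).trans hball
  have hder : ∀ᵐ x ∂μ, ∀ s ∈ Metric.ball s₀ r,
      HasDerivAt (fun s => f s x) (deriv (fun s => f s x) s) s := by
    filter_upwards [hd] with x hx s hs
    exact (hx.differentiableAt (hU.mem_nhds (hsub2 hs))).hasDerivAt
  have hmd : AEStronglyMeasurable (fun x => deriv (fun s => f s x) s₀) μ := by
    let sq : ℕ → ℂ := fun n => s₀ + ((r / (n + 2) : ℝ) : ℂ)
    have hsq : ∀ n, sq n ∈ Metric.ball s₀ r := by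
      intro n
      simp only [sq, Metric.mem_ball, dist_eq_norm, add_sub_cancel_left, Complex.norm_real]
      rw [Real.norm_of_nonneg (by positivity), div_lt_iff₀ (by positivity)]
      have : (0:ℝ) ≤ n := by positivity
      nlinarith
    have hne : ∀ n, sq n ≠ s₀ := by
      intro n h
      have : ((r / (n + 2) : ℝ) : ℂ) = 0 := by simpa [sq] using h
      have h2 : r / ((n:ℝ) + 2) = 0 := by exact_mod_cast this
      have : 0 < r / ((n:ℝ) + 2) := by positivity
      linarith
    have hlim : Tendsto sq atTop (𝓝[≠] s₀) := by
      refine tendsto_nhdsWithin_iff.2 ⟨?_, Eventually.of_forall hne⟩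
      have h1 : Tendsto (fun n : ℕ => r / ((n:ℝ) + 2)) atTop (𝓝 0) :=
        Tendsto.div_atTop tendsto_const_nhds
          (tendsto_atTop_add_const_right _ _ tendsto_natCast_atTop_atTop)
      have h2 : Tendsto (fun n : ℕ => ((r / ((n:ℝ) + 2) : ℝ) : ℂ)) atTop (𝓝 ((0:ℝ):ℂ)) :=
        (Complex.continuous_ofReal.tendsto _).comp h1
      simpa [sq] using (tendsto_const_nhds (x := s₀)).add h2
    refine aestronglyMeasurable_of_tendsto_ae atTop
      (f := fun n x => slope (fun s => f s x) s₀ (sq n)) ?_ ?_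
    · intro n
      simp only [slope_def_module]
      exact ((hm _ (hsub2 (hsq n))).sub (hm _ hs₀)).const_smul ((sq n - s₀)⁻¹)
    · filter_upwards [hder] with x hx
      exact (hasDerivAt_iff_tendsto_slope.1 (hx s₀ (Metric.mem_ball_self hrpos))).comp hlim
  have hmain := hasDerivAt_integral_of_dominated_loc_of_deriv_le (μ := μ) (F := f)
    (F' := fun s x => deriv (fun s => f s x) s) (x₀ := s₀) (s := Metric.ball s₀ (r/2))
    (bound := fun x => b x / (r/4)) (Metric.ball_mem_nhds _ (by positivity))
    (by
      filter_upwards [Metric.ball_mem_nhds s₀ hrpos] with s hs using hm s (hsub2 hs))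
    (by
      refine hbi.mono' (hm _ hs₀) ?_
      filter_upwards [hbb] with x hx using hx _ (Metric.mem_ball_self hr₁))
    hmd
    (by
      filter_upwards [hbb, hd] with x hx hdx s hs
      refine Complex.norm_deriv_le_of_forall_mem_sphere_norm_le (by positivity) ?_ ?_
      · refine DifferentiableOn.diffContOnCl (hdx.mono ?_)
        rw [closure_ball _ (by positivity)]
        refine Subset.trans ?_ hsub2
        intro y hy
        simp only [Metric.mem_ball, Metric.mem_closedBall] at *
        linarith [dist_triangle y s s₀]
      · intro y hy
        apply hx
        apply hsub1
        simp only [Metric.mem_ball, Metric.mem_sphere] at *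
        linarith [dist_triangle y s s₀])
    (hbi.div_const _)
    (by
      filter_upwards [hder] with x hx s hs
      exact hx s (Metric.ball_subset_ball (by linarith) hs))
  exact hmain.2.differentiableAt.differentiableWithinAt

lemma poch_zero (a : ℂ) : poch a 0 = 1 := by simp [poch]

lemma poch_succ (a : ℂ) (n : ℕ) : poch a (n+1) = poch a n * (a + n) := by
  simp [poch, ascPochhammer_succ_eval]

lemma poch_succ' (a : ℂ) (n : ℕ) : poch a (n+1) = a * poch (a+1) n := by
  simp [poch, ascPochhammer_succ_left]

lemma poch_ne_zero (a : ℂ) (ha : 0 < a.re) (n : ℕ) : poch a n ≠ 0 := by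
  induction n with
  | zero => simp [poch_zero]
  | succ n ih =>
    rw [poch_succ]
    refine mul_ne_zero ih ?_
    intro h
    have := congrArg Complex.re h
    simp at this
    have : (0:ℝ) ≤ n := by positivity
    linarith

lemma poch_gamma (a : ℂ) (ha : 0 < a.re) (n : ℕ) :
    Complex.Gamma (a + n) = poch a n * Complex.Gamma a := by
  induction n with
  | zero => simp [poch_zero]
  | succ n ih =>
    rw [poch_succ]
    push_cast
    rw [← add_assoc, Complex.Gamma_add_one, ih]
    · ring
    · intro h
      have := congrArg Complex.re h
      simp at this
      have : (0:ℝ) ≤ n := by positivity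
      linarith

lemma fact_poch (n : ℕ) : ((2 * n + 1).factorial : ℂ) = 4 ^ n * n.factorial * poch (3/2) n := by
  induction n with
  | zero => simp [poch_zero]
  | succ n ih =>
    rw [poch_succ, show 2 * (n+1) + 1 = (2 * n + 1) + 1 + 1 by ring, Nat.factorial_succ (2*n+1+1),
      Nat.factorial_succ (2*n+1), Nat.factorial_succ n]
    push_cast
    rw [ih]
    ring

lemma poch_half (n : ℕ) : poch (1/2) n / poch (3/2) n = 1 / (2 * n + 1) := by
  have h : ∀ n : ℕ, poch (3/2) n = poch (1/2) n * (2 * n + 1) := by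
    intro n
    induction n with
    | zero => simp [poch_zero]
    | succ n ih =>
      rw [poch_succ, poch_succ, ih]
      push_cast
      ring
  have h1 := poch_ne_zero (1/2) (by norm_num) n
  rw [h]
  field_simp

lemma chuV (n : ℕ) : ∀ (a c : ℂ), 0 < c.re →
    ∑ k ∈ Finset.range (n+1), (n.choose k : ℂ) * (-1)^k * (poch a k / poch c k)
      = poch (c - a) n / poch c n := by
  induction n with
  | zero => intro a c hc; simp [poch_zero]
  | succ n ih =>
    intro a c hc
    have hc1 : 0 < (c+1).re := by simp; linarith
    have e1 := ih a c hc
    have e2 := ih (a+1) (c+1) hc1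
    have hc0 : c ≠ 0 := by rintro rfl; simp at hc
    rw [Finset.sum_range_succ']
    have : ∀ k, ((n+1).choose (k+1) : ℂ) * (-1)^(k+1) * (poch a (k+1) / poch c (k+1))
        = (n.choose (k+1) : ℂ) * (-1)^(k+1) * (poch a (k+1) / poch c (k+1))
          - (a / c) * ((n.choose k : ℂ) * (-1)^k * (poch (a+1) k / poch (c+1) k)) := by
      intro k
      have h1 := poch_ne_zero (c+1) hc1 k
      rw [Nat.choose_succ_succ, poch_succ' a, poch_succ' c]
      push_cast
      field_simp
      ring
    simp only [this]
    rw [Finset.sum_sub_distrib, ← Finset.mul_sum, e2]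
    have e3 : ∑ k ∈ Finset.range (n+1), (n.choose (k+1) : ℂ) * (-1)^(k+1)
        * (poch a (k+1) / poch c (k+1)) = poch (c - a) n / poch c n - 1 := by
      rw [← e1, Finset.sum_range_succ, Finset.sum_range_succ' _ n]
      simp [poch_zero]
    rw [e3]
    have hp := poch_ne_zero c hc n
    have hp1 := poch_ne_zero (c+1) hc1 n
    have hq : poch c n * (c + n) = c * poch (c+1) n := by rw [← poch_succ, poch_succ']
    have hcn : c + n ≠ 0 := by
      intro h; rw [h, mul_zero] at hq
      exact mul_ne_zero hc0 hp1 hq.symm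
    have : poch (c+1) n = poch c n * (c+n) / c := by rw [hq]; field_simp
    rw [this, poch_succ (c-a), poch_succ c, show c + 1 - (a+1) = c - a by ring]
    simp [poch_zero]
    field_simp
    ring


lemma summable_oneF1 (a c x : ℂ) (hc : 0 < c.re) :
    Summable (fun n : ℕ => ‖poch a n / poch c n * x ^ n / (n.factorial : ℂ)‖) := by
  refine summable_of_ratio_norm_eventually_le (r := 1/2) (by norm_num) ?_
  have h1 : ∀ᶠ n : ℕ in atTop, 2 * ((‖a‖ + 1) * ‖x‖) ≤ (n:ℝ) :=
    tendsto_natCast_atTop_atTop.eventually_ge_atTop _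
  filter_upwards [h1, eventually_ge_atTop 1] with n hn hn1
  have hn1' : (1:ℝ) ≤ n := by exact_mod_cast hn1
  have hcn : (n:ℝ) ≤ ‖c + n‖ := by
    have := Complex.abs_re_le_norm (c + n)
    simp at this
    have h2 := le_abs_self (c.re + n)
    linarith
  have han : ‖a + n‖ ≤ ‖a‖ + n := by
    refine (norm_add_le _ _).trans ?_
    simp
  have hratio : ‖a + n‖ / ‖c + n‖ ≤ ‖a‖ + 1 := by
    rw [div_le_iff₀ (by linarith)]
    have : 0 ≤ ‖a‖ := norm_nonneg a
    nlinarith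
  rw [norm_norm, norm_norm, poch_succ, poch_succ, pow_succ, Nat.factorial_succ]
  have e : poch a n * (a + n) / (poch c n * (c + n)) * (x ^ n * x) / (((n+1) * n.factorial : ℕ) : ℂ)
     = (poch a n / poch c n * x ^ n / (n.factorial : ℂ)) * ((a + n) / (c + n) * x / ((n:ℂ)+1)) := by
    push_cast
    simp only [div_eq_mul_inv, mul_inv]
    ring
  rw [e, norm_mul, mul_comm]
  refine mul_le_mul_of_nonneg_right ?_ (norm_nonneg _)
  have e2 : ‖(n:ℂ) + 1‖ = n + 1 := by
    have : ((n:ℂ) + 1) = ((n + 1 : ℝ) : ℂ) := by push_cast; rfl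
    rw [this, Complex.norm_of_nonneg (by positivity)]
  rw [norm_div, norm_mul, norm_div, e2, div_le_iff₀ (by positivity)]
  have : ‖a + n‖ / ‖c + n‖ * ‖x‖ ≤ (‖a‖ + 1) * ‖x‖ :=
    mul_le_mul_of_nonneg_right hratio (norm_nonneg _)
  linarith

lemma kummer (a c x : ℂ) (hc : 0 < c.re) :
    oneF1 a c x * Complex.exp (-x) = oneF1 (c - a) c (-x) := by
  have hexp : Complex.exp (-x) = ∑' n : ℕ, (-x) ^ n / (n.factorial : ℂ) := by
    rw [Complex.exp_eq_exp_ℂ, NormedSpace.exp_eq_tsum_div]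
  have hs : Summable (fun n : ℕ => ‖(-x) ^ n / (n.factorial : ℂ)‖) :=
    NormedSpace.norm_expSeries_div_summable (-x)
  rw [hexp, oneF1, tsum_mul_tsum_eq_tsum_sum_range_of_summable_norm (summable_oneF1 a c x hc) hs,
    oneF1]
  refine tsum_congr fun n => ?_
  rw [← chuV n a c hc, Finset.sum_mul, Finset.sum_div]
  refine Finset.sum_congr rfl fun k hk => ?_
  have hk' : k ≤ n := by simpa [Nat.lt_succ_iff] using hk
  have hfac : (n.choose k : ℂ) = n.factorial / (k.factorial * (n-k).factorial) := by
    rw [Nat.cast_choose ℂ hk']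
  rw [hfac]
  have h1 : (n.factorial : ℂ) ≠ 0 := by exact_mod_cast n.factorial_ne_zero
  have h2 : (k.factorial : ℂ) ≠ 0 := by exact_mod_cast k.factorial_ne_zero
  have h3 : ((n-k).factorial : ℂ) ≠ 0 := by exact_mod_cast (n-k).factorial_ne_zero
  have h4 := poch_ne_zero c hc k
  have h5 : (-x)^n = (-1)^k * x^k * (-x)^(n-k) := by
    rw [← mul_pow, neg_one_mul, ← pow_add, Nat.add_sub_cancel' hk']
  have h6 : ((-1:ℂ)^k) * (-1)^k = 1 := by rw [← mul_pow]; simp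
  rw [h5]
  field_simp
  linear_combination (-(poch a k * x ^ k * (-x) ^ (n - k))) * h6

lemma cerf_eq (w : ℂ) (hw : w ≠ 0) :
    ((Real.sqrt Real.pi : ℂ) / w) * cerf (w / 2) = oneF1 (1/2) (3/2) (-(w^2/4)) := by
  have hpi : (Real.sqrt Real.pi : ℂ) ≠ 0 := by
    have : Real.sqrt Real.pi ≠ 0 := by positivity
    exact_mod_cast this
  have h1 : ((Real.sqrt Real.pi : ℂ) / w) * cerf (w / 2)
      = ∫ t in (0:ℝ)..1, Complex.exp (-(t * (w/2)) ^ 2) := by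
    rw [cerf, intervalIntegral.integral_const_mul]
    field_simp
  rw [h1]
  set X : ℂ := -(w^2/4) with hX
  have h2 : HasSum (fun n : ℕ => ∫ t in (0:ℝ)..1, (X * (t:ℂ)^2) ^ n / (n.factorial : ℂ))
      (∫ t in (0:ℝ)..1, Complex.exp (-(t * (w/2)) ^ 2)) := by
    refine intervalIntegral.hasSum_integral_of_dominated_convergence
      (fun n _ => ‖X‖ ^ n / n.factorial) ?_ ?_ ?_ ?_ ?_
    · intro n
      have : Continuous (fun t : ℝ => (X * (t:ℂ)^2) ^ n / (n.factorial : ℂ)) := by fun_prop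
      exact this.aestronglyMeasurable
    · intro n
      refine Eventually.of_forall fun t ht => ?_
      rw [uIoc_of_le (by norm_num)] at ht
      rw [norm_div, norm_pow, norm_mul, norm_pow, Complex.norm_natCast, Complex.norm_real,
        Real.norm_of_nonneg ht.1.le]
      gcongr
      exact mul_le_of_le_one_right (norm_nonneg _) (pow_le_one₀ ht.1.le ht.2)
    · exact Eventually.of_forall fun t ht => Real.summable_pow_div_factorial _
    · simp
    · refine Eventually.of_forall fun t ht => ?_
      have : -((t:ℂ) * (w/2))^2 = X * (t:ℂ)^2 := by rw [hX]; ring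
      rw [this, Complex.exp_eq_exp_ℂ]
      exact NormedSpace.expSeries_div_hasSum_exp (X * (t:ℂ)^2)
  rw [← h2.tsum_eq, oneF1]
  refine tsum_congr fun n => ?_
  rw [poch_half]
  have : ∀ t : ℝ, (X * (t:ℂ)^2) ^ n / (n.factorial : ℂ)
      = (X ^ n / n.factorial) * ((t ^ (2 * n) : ℝ) : ℂ) := by
    intro t; push_cast; rw [mul_pow, ← pow_mul]; ring
  simp only [this]
  rw [intervalIntegral.integral_const_mul, intervalIntegral.integral_ofReal, integral_pow]
  push_cast
  simp
  ring

lemma Afun_eq (w z : ℂ) (hw : w ≠ 0) :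
    Afun w z = oneF1 (1/2) (3/2) (-(w^2/4)) * oneF1 (1 + z/2) (3/2) (w^2/4) := by
  rw [Afun, cerf_eq w hw]

lemma Afun_eq' (w z : ℂ) (hw : w ≠ 0) :
    Afun w z = oneF1 1 (3/2) (w^2/4) * oneF1 ((1 - z)/2) (3/2) (-(w^2/4)) := by
  rw [Afun_eq w z hw]
  have h1 := kummer (1/2) (3/2) (-(w^2/4)) (by norm_num)
  have h2 := kummer (1 + z/2) (3/2) (w^2/4) (by norm_num)
  rw [neg_neg] at h1
  rw [show (3/2 - 1/2 : ℂ) = 1 by norm_num] at h1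
  rw [show (3/2 - (1 + z/2) : ℂ) = (1-z)/2 by ring] at h2
  rw [← h1, ← h2]
  have : Complex.exp (w^2/4) * Complex.exp (-(w^2/4)) = 1 := by
    rw [← Complex.exp_add]; simp
  linear_combination (-1) * oneF1 (1/2) (3/2) (-(w^2/4)) * oneF1 (1 + z/2) (3/2) (w^2/4) * this

/-- The theta remainder. -/
def Hth (T : ℝ) : ℝ := 2 * Real.sqrt (Real.pi / T) * ∑' n : ℕ+, Real.exp (-(Real.pi^2 * (n:ℝ)^2 / T))

lemma summable_gauss_int (c : ℝ) (hc : 0 < c) : Summable (fun n : ℤ => Real.exp (-c * (n:ℝ)^2)) := by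
  have := summable_pow_mul_jacobiTheta₂_term_bound 0 (T := c / Real.pi) (by positivity) 0
  refine this.congr fun n => ?_
  simp only [pow_zero, one_mul]
  congr 1
  simp only [mul_zero, zero_mul, sub_zero]
  field_simp

lemma exp_neg_le_rpow (x p : ℝ) (hx : 0 < x) (hp0 : 0 ≤ p) (hp1 : p ≤ 1) :
    Real.exp (-x) ≤ x ^ (-p) := by
  have h1 : x ^ p ≤ Real.exp x := by
    have h2 : x ^ p ≤ (Real.exp x) ^ p :=
      Real.rpow_le_rpow hx.le (by linarith [Real.add_one_le_exp x]) hp0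
    refine h2.trans ?_
    calc (Real.exp x) ^ p ≤ (Real.exp x) ^ (1:ℝ) :=
          Real.rpow_le_rpow_of_exponent_le (by linarith [Real.add_one_le_exp x]) hp1
      _ = _ := Real.rpow_one _
  rw [Real.exp_neg, Real.rpow_neg hx.le]
  exact inv_anti₀ (by positivity) h1

lemma theta_split (c : ℝ) (hc : 0 < c) : ∑' n : ℤ, Real.exp (-c * (n:ℝ)^2)
    = 1 + 2 * ∑' n : ℕ+, Real.exp (-c * (n:ℝ)^2) := by
  rw [tsum_int_eq_zero_add_two_mul_tsum_pnat _ (summable_gauss_int c hc)]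
  · simp
  · intro n; simp

lemma theta_eq (T : ℝ) (hT : 0 < T) : ∑' n : ℕ+, Real.exp (-((n:ℝ)^2 * T))
    = Real.sqrt (Real.pi / T) / 2 - 1/2 + Hth T / 2 := by
  have h := Real.tsum_exp_neg_mul_int_sq (a := T / Real.pi) (by positivity)
  have e1 : ∀ n : ℤ, -Real.pi * (T / Real.pi) * (n:ℝ)^2 = -T * (n:ℝ)^2 := by
    intro n; field_simp
  have e2 : ∀ n : ℤ, -Real.pi / (T / Real.pi) * (n:ℝ)^2 = -(Real.pi^2/T) * (n:ℝ)^2 := by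
    intro n; field_simp
  simp only [e1, e2] at h
  rw [theta_split T hT, theta_split _ (by positivity), ← Real.sqrt_eq_rpow] at h
  have e3 : 1 / Real.sqrt (T / Real.pi) = Real.sqrt (Real.pi / T) := by
    rw [one_div, ← Real.sqrt_inv, inv_div]
  rw [e3] at h
  have e4 : ∀ n : ℕ+, Real.exp (-((n:ℝ)^2 * T)) = Real.exp (-T * (n:ℝ)^2) := by
    intro n; congr 1; ring
  have e5 : ∀ n : ℕ+, Real.exp (-(Real.pi^2 * (n:ℝ)^2 / T)) = Real.exp (-(Real.pi^2/T) * (n:ℝ)^2) := by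
    intro n; congr 1; ring
  simp only [Hth, e4, e5]
  linarith

lemma Hth_nonneg (T : ℝ) : 0 ≤ Hth T :=
  mul_nonneg (by positivity) (tsum_nonneg fun n => (Real.exp_pos _).le)

lemma Hth_measurable : Measurable Hth := by
  unfold Hth
  refine Measurable.mul (by fun_prop) ?_
  exact Measurable.tsum fun n => by fun_prop

lemma summable_pnat_rpow (p : ℝ) (hp : 1 < p) : Summable (fun n : ℕ+ => (n:ℝ) ^ (-p)) := by
  have := (Real.summable_nat_rpow (p := -p)).2 (by linarith)
  exact this.comp_injective PNat.coe_injective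

lemma Hth_bound (a : ℝ) (ha0 : 0 < a) (ha1 : a < 1) :
    ∃ c : ℝ, 0 ≤ c ∧ ∀ T : ℝ, 0 < T → Hth T ≤ c * T ^ (a/2) := by
  set p : ℝ := (1 + a)/2 with hp
  refine ⟨2 * Real.sqrt Real.pi * ((Real.pi^2) ^ (-p) * ∑' n : ℕ+, (n:ℝ) ^ (-(2*p))), ?_, ?_⟩
  · have : 0 ≤ ∑' n : ℕ+, (n:ℝ) ^ (-(2*p)) := tsum_nonneg fun n => by positivity
    positivity
  intro T hT
  have hs := summable_pnat_rpow (2*p) (by rw [hp]; linarith)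
  have hb : ∀ n : ℕ+, Real.exp (-(Real.pi^2 * (n:ℝ)^2 / T))
      ≤ ((Real.pi^2) ^ (-p) * T ^ p) * (n:ℝ) ^ (-(2*p)) := by
    intro n
    have hn : (0:ℝ) < n := by exact_mod_cast n.pos
    refine (exp_neg_le_rpow _ p (by positivity) (by rw [hp]; linarith) (by rw [hp]; linarith)).trans ?_
    apply le_of_eq
    rw [Real.div_rpow (by positivity) hT.le, Real.mul_rpow (by positivity) (by positivity),
      Real.rpow_neg hT.le p, ← Real.rpow_natCast (n:ℝ) 2, ← Real.rpow_mul hn.le]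
    rw [show ((2:ℕ):ℝ) * -p = -(2*p) by push_cast; ring]
    field_simp
  have h1 : ∑' n : ℕ+, Real.exp (-(Real.pi^2 * (n:ℝ)^2 / T))
      ≤ ((Real.pi^2) ^ (-p) * T ^ p) * ∑' n : ℕ+, (n:ℝ) ^ (-(2*p)) := by
    rw [← tsum_mul_left]
    exact Summable.tsum_le_tsum hb
      (Summable.of_nonneg_of_le (fun n => (Real.exp_pos _).le) hb (hs.mul_left _)) (hs.mul_left _)
  rw [Hth]
  refine (mul_le_mul_of_nonneg_left h1 (by positivity)).trans (le_of_eq ?_)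
  rw [Real.sqrt_div Real.pi_pos.le, Real.sqrt_eq_rpow T]
  have : T ^ p = T ^ (1/2:ℝ) * T ^ (a/2) := by
    rw [← Real.rpow_add hT]; congr 1; rw [hp]; ring
  rw [this]
  have hT2 : T ^ (1/2:ℝ) ≠ 0 := by positivity
  field_simp


/-- Lebesgue measure on the positive half line. -/
def mup : Measure ℝ := volume.restrict (Ioi (0:ℝ))

instance : SFinite mup := by unfold mup; infer_instance

lemma mup_pos : ∀ᵐ u ∂mup, 0 < u := by
  unfold mup
  exact ae_restrict_mem measurableSet_Ioi

/-- Basic one-variable kernel. -/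
def fs (w p : ℂ) (u : ℝ) : ℂ := (u:ℂ)^(p-1) * cexp (-(u:ℂ)^2) * Complex.sinh (w * u)

lemma fs_meas (w p : ℂ) : Measurable (fs w p) := by
  unfold fs
  fun_prop

lemma norm_sinh_le (z : ℂ) : ‖Complex.sinh z‖ ≤ ‖z‖ * Real.exp ‖z‖ := by
  have h1 := Complex.norm_exp_sub_sum_le_norm_mul_exp z 1
  have h2 := Complex.norm_exp_sub_sum_le_norm_mul_exp (-z) 1
  simp at h1 h2
  have : Complex.sinh z = ((cexp z - 1) - (cexp (-z) - 1)) / 2 := by rw [Complex.sinh]; ring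
  rw [this, norm_div]
  have := norm_sub_le (cexp z - 1) (cexp (-z) - 1)
  rw [Complex.norm_ofNat]
  linarith

lemma cpe (u : ℝ) (hu : 0 < u) (s : ℂ) : (u:ℂ)^s = cexp ((Real.log u : ℂ) * s) := by
  have hu' : (u:ℂ) ≠ 0 := by exact_mod_cast hu.ne'
  rw [Complex.cpow_def_of_ne_zero hu', Complex.ofReal_log hu.le]

lemma norm_fs_le (w p : ℂ) (u : ℝ) (hu : 0 < u) :
    ‖fs w p u‖ ≤ (‖w‖ * Real.exp (‖w‖^2/2)) * (u ^ p.re * Real.exp (-(1/2) * u^2)) := by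
  rw [fs, norm_mul, norm_mul, Complex.norm_cpow_eq_rpow_re_of_pos hu, Complex.norm_exp]
  have e1 : (-(u:ℂ)^2).re = -u^2 := by
    rw [← Complex.ofReal_pow, ← Complex.ofReal_neg, Complex.ofReal_re]
  have h1 := norm_sinh_le (w * u)
  rw [norm_mul, Complex.norm_real, Real.norm_of_nonneg hu.le] at h1
  rw [e1, Complex.sub_re, Complex.one_re]
  have e2 : u ^ p.re = u ^ (p.re - 1) * u := by
    rw [Real.rpow_sub_one hu.ne']; field_simp
  calc u ^ (p.re - 1) * Real.exp (-u^2) * ‖Complex.sinh (w * u)‖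
      ≤ u ^ (p.re - 1) * Real.exp (-u^2) * (‖w‖ * u * Real.exp (‖w‖ * u)) := by gcongr
    _ = ‖w‖ * u ^ p.re * Real.exp (-u^2 + ‖w‖ * u) := by rw [Real.exp_add, e2]; ring
    _ ≤ ‖w‖ * u ^ p.re * Real.exp (‖w‖^2/2 + (-(1/2) * u^2)) := by
        refine mul_le_mul_of_nonneg_left (Real.exp_le_exp.2 ?_) (by positivity)
        nlinarith [sq_nonneg (u - ‖w‖)]
    _ = _ := by rw [Real.exp_add]; ring

lemma fs_int_rpow (w p : ℂ) (r : ℝ) (h : -1 < p.re + r) :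
    Integrable (fun u => ‖fs w p u‖ * u ^ r) mup := by
  have h1 : Integrable (fun u : ℝ => u ^ (p.re + r) * Real.exp (-(1/2) * u^2)) mup :=
    integrableOn_rpow_mul_exp_neg_mul_sq (by norm_num) h
  refine (h1.const_mul (‖w‖ * Real.exp (‖w‖^2/2))).mono' ?_ ?_
  · have := fs_meas w p
    exact (by fun_prop : Measurable (fun u => ‖fs w p u‖ * u ^ r)).aestronglyMeasurable
  · filter_upwards [mup_pos] with u hu
    rw [Real.norm_of_nonneg (by positivity), Real.rpow_add hu]
    have := mul_le_mul_of_nonneg_right (norm_fs_le w p u hu) (Real.rpow_nonneg hu.le r)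
    linarith

lemma fs_int (w p : ℂ) (h : -1 < p.re) : Integrable (fs w p) mup := by
  have := fs_int_rpow w p 0 (by linarith)
  simp only [Real.rpow_zero, mul_one] at this
  exact (integrable_norm_iff (fs_meas w p).aestronglyMeasurable).1 this

/-- Mellin-type transform of the kernel. -/
def Mf (w p : ℂ) : ℂ := ∫ u, fs w p u ∂mup

lemma rpow_le_add (x a b c : ℝ) (hx : 0 < x) (h1 : a ≤ b) (h2 : b ≤ c) : x ^ b ≤ x ^ a + x ^ c := by
  have ha : 0 < x ^ a := by positivity
  have hc : 0 < x ^ c := by positivity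
  rcases le_total 1 x with h | h
  · have := Real.rpow_le_rpow_of_exponent_le h h2
    linarith
  · have := Real.rpow_le_rpow_of_exponent_ge hx h h1
    linarith

lemma Mf_diff (w : ℂ) : DifferentiableOn ℂ (Mf w) {p : ℂ | -1 < p.re} := by
  unfold Mf
  refine differentiableOn_integral_param mup _ (isOpen_lt continuous_const Complex.continuous_re)
    (fs w) (fun p _ => (fs_meas w p).aestronglyMeasurable) ?_ ?_
  · filter_upwards [mup_pos] with u hu
    have hu' : (u:ℂ) ≠ 0 := by exact_mod_cast hu.ne'
    unfold fs
    intro p _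
    refine DifferentiableAt.differentiableWithinAt ?_
    refine ((DifferentiableAt.const_cpow (by fun_prop) (Or.inl hu')).mul_const _).mul_const _
  · intro p₀ hp₀
    have hp₀' : -1 < p₀.re := hp₀
    set r : ℝ := (p₀.re + 1)/2 with hr
    have hrp : 0 < r := by linarith
    refine ⟨r, hrp, fun u => ‖fs w p₀ u‖ * u ^ (-r) + ‖fs w p₀ u‖ * u ^ r,
      (fs_int_rpow w p₀ _ (by linarith)).add (fs_int_rpow w p₀ _ (by linarith)), ?_⟩
    filter_upwards [mup_pos] with u hu p hp
    have hd : |p.re - p₀.re| < r := by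
      have := Complex.abs_re_le_norm (p - p₀)
      rw [Complex.sub_re] at this
      rw [Metric.mem_ball, dist_eq_norm] at hp
      linarith
    rw [abs_lt] at hd
    have e : ‖fs w p u‖ = ‖fs w p₀ u‖ * u ^ (p.re - p₀.re) := by
      simp only [fs, norm_mul, Complex.norm_cpow_eq_rpow_re_of_pos hu, Complex.sub_re,
        Complex.one_re]
      rw [show p.re - 1 = (p₀.re - 1) + (p.re - p₀.re) by ring, Real.rpow_add hu]
      ring
    rw [e, ← mul_add]
    exact mul_le_mul_of_nonneg_left (rpow_le_add _ _ _ _ hu hd.1.le hd.2.le) (norm_nonneg _)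

lemma gauss_cpow (q : ℂ) (hq : 0 < q.re) :
    ∫ u, (u:ℂ)^(2 * q - 1) * cexp (-(u:ℂ)^2) ∂mup = Complex.Gamma q / 2 := by
  rw [Complex.Gamma_eq_integral hq, Complex.GammaIntegral]
  have h := integral_comp_rpow_Ioi (fun y : ℝ => ((Real.exp (-y) : ℝ) : ℂ) * (y:ℂ)^(q-1))
    (p := 2) (by norm_num)
  rw [← h, mup, ← integral_div]
  refine setIntegral_congr_fun measurableSet_Ioi fun u hu => ?_
  have hu : 0 < u := hu
  have hu' : (u:ℂ) ≠ 0 := by exact_mod_cast hu.ne'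
  simp only [Complex.real_smul]
  have h1 : (0:ℝ) < u ^ (2:ℝ) := by positivity
  have e0 : ((|(2:ℝ)| * u ^ ((2:ℝ) - 1) : ℝ) : ℂ) = 2 * cexp (Real.log u : ℂ) := by
    rw [← Complex.ofReal_exp, Real.exp_log hu]
    norm_num
  have e1 : ((Real.exp (-(u ^ (2:ℝ))) : ℝ) : ℂ) = cexp (-(u:ℂ)^2) := by
    push_cast [Real.rpow_two]; rfl
  rw [e0, e1, cpe _ h1, cpe _ hu, Real.log_rpow hu]
  have e3 : cexp ((Real.log u : ℂ) * (2 * q - 1))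
      = cexp (Real.log u : ℂ) * cexp (((2 * Real.log u : ℝ) : ℂ) * (q - 1)) := by
    rw [← Complex.exp_add]
    congr 1
    push_cast; ring
  rw [e3]
  ring

lemma Mf_eq (w p : ℂ) (hp : -1 < p.re) :
    Mf w p = 1/2 * Complex.Gamma ((p+1)/2) * w * oneF1 ((p+1)/2) (3/2) (w^2/4) := by
  have hq : 0 < ((p+1)/2).re := by
    have : ((p+1)/2).re = (p.re + 1)/2 := by simp
    rw [this]; linarith
  set q := (p+1)/2 with hqd
  have hS : HasSum (fun n : ℕ => ∫ u, (u:ℂ)^(p-1) * cexp (-(u:ℂ)^2) *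
      ((w * u) ^ (2*n+1) / ((2*n+1).factorial : ℂ)) ∂mup) (∫ u, fs w p u ∂mup) := by
    refine hasSum_integral_of_dominated_convergence
      (fun n u => ‖(u:ℂ)^(p-1) * cexp (-(u:ℂ)^2)‖ *
        ((‖w‖ * |u|) ^ (2*n+1) / ((2*n+1).factorial : ℝ))) ?_ ?_ ?_ ?_ ?_
    · intro n
      exact (by fun_prop : Measurable (fun u : ℝ => (u:ℂ)^(p-1) * cexp (-(u:ℂ)^2) *
      ((w * u) ^ (2*n+1) / ((2*n+1).factorial : ℂ)))).aestronglyMeasurable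
    · intro n
      filter_upwards with u
      rw [norm_mul, norm_div, norm_pow, norm_mul w, Complex.norm_real, Complex.norm_natCast,
        Real.norm_eq_abs]
    · filter_upwards with u
      exact (Real.hasSum_sinh _).summable.mul_left _
    · have h1 := (fs_int ‖w‖ p hp).norm
      refine h1.congr ?_
      filter_upwards [mup_pos] with u hu
      rw [tsum_mul_left, (Real.hasSum_sinh _).tsum_eq, fs, norm_mul]
      congr 1
      rw [abs_of_pos hu, ← Complex.ofReal_mul, ← Complex.ofReal_sinh, Complex.norm_real,
        Real.norm_of_nonneg]
      exact Real.sinh_nonneg_iff.2 (by positivity)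
    · filter_upwards with u
      exact (Complex.hasSum_sinh _).mul_left _
  rw [Mf, ← hS.tsum_eq, oneF1, ← tsum_mul_left]
  refine tsum_congr fun n => ?_
  have hqn : 0 < (q + n).re := by
    have : (0:ℝ) ≤ n := by positivity
    simp only [Complex.add_re, Complex.natCast_re]; linarith
  have e : ∫ u, (u:ℂ)^(p-1) * cexp (-(u:ℂ)^2) *
      ((w * u) ^ (2*n+1) / ((2*n+1).factorial : ℂ)) ∂mup
      = ∫ u, (w ^ (2*n+1) / ((2*n+1).factorial : ℂ)) *
        ((u:ℂ)^(2 * (q + n) - 1) * cexp (-(u:ℂ)^2)) ∂mup := by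
    refine integral_congr_ae ?_
    filter_upwards [mup_pos] with u hu
    have hu' : (u:ℂ) ≠ 0 := by exact_mod_cast hu.ne'
    have : (u:ℂ)^(2 * (q + n) - 1) = (u:ℂ)^(p-1) * (u:ℂ)^(2*n+1) := by
      rw [← Complex.cpow_natCast, ← Complex.cpow_add _ _ hu']
      congr 1
      rw [hqd]; push_cast; ring
    rw [this, mul_pow]
    ring
  rw [e, integral_const_mul, gauss_cpow _ hqn, poch_gamma q hq, fact_poch]
  have h4 : (n.factorial : ℂ) ≠ 0 := by exact_mod_cast n.factorial_ne_zero
  have h5 := poch_ne_zero (3/2) (by norm_num) n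
  rw [div_pow, pow_succ, pow_mul]
  field_simp


/-- Product measure on the positive octant. -/
def mu3 : Measure ((ℝ × ℝ) × ℝ) := (mup.prod mup).prod mup

lemma mu2_pos : ∀ᵐ p ∂(mup.prod mup), 0 < p.1 ∧ 0 < p.2 := by
  unfold mup
  rw [Measure.prod_restrict]
  filter_upwards [ae_restrict_mem (measurableSet_Ioi.prod measurableSet_Ioi)] with p hp
  exact hp

lemma mu3_pos : ∀ᵐ p ∂mu3, 0 < p.1.1 ∧ 0 < p.1.2 ∧ 0 < p.2 := by
  unfold mu3 mup
  rw [Measure.prod_restrict, Measure.prod_restrict]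
  filter_upwards [ae_restrict_mem
    ((measurableSet_Ioi.prod measurableSet_Ioi).prod measurableSet_Ioi)] with p hp
  exact ⟨hp.1.1, hp.1.2, hp.2⟩

/-- Gamma kernel. -/
def ft (s : ℂ) (t : ℝ) : ℂ := (t:ℂ)^(s/2-1) * cexp (-(t:ℂ))

lemma ft_meas (s : ℂ) : Measurable (ft s) := by
  unfold ft
  fun_prop

lemma norm_ft (s : ℂ) (t : ℝ) (ht : 0 < t) :
    ‖ft s t‖ = t ^ (s.re/2 - 1) * Real.exp (-t) := by
  rw [ft, norm_mul, Complex.norm_cpow_eq_rpow_re_of_pos ht, Complex.norm_exp]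
  simp

lemma ft_int_rpow (s : ℂ) (r : ℝ) (h : 0 < s.re / 2 + r) :
    Integrable (fun t => ‖ft s t‖ * t ^ r) mup := by
  have h1 := Real.GammaIntegral_convergent h
  refine Integrable.congr (h1 : Integrable _ mup) ?_
  filter_upwards [mup_pos] with t ht
  rw [norm_ft s t ht, show s.re/2 + r - 1 = (s.re/2 - 1) + r by ring, Real.rpow_add ht]
  ring

lemma ft_integral (s : ℂ) (hs : 0 < s.re) : ∫ t, ft s t ∂mup = Complex.Gamma (s/2) := by
  have hs2 : 0 < (s/2).re := by simp [hs]
  rw [Complex.Gamma_eq_integral hs2, Complex.GammaIntegral, mup]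
  refine integral_congr_ae (Eventually.of_forall fun t => ?_)
  simp only [ft]
  push_cast
  ring

/-- The three-variable kernel. -/
def Qk (w s : ℂ) (p : (ℝ × ℝ) × ℝ) : ℂ :=
  -I * (fs w s p.1.1 * fs (I * w) 0 p.1.2) * ft s p.2

/-- The theta variable. -/
def Tt (p : (ℝ × ℝ) × ℝ) : ℝ := p.2 * p.1.1^2 / p.1.2^2

lemma Tt_meas : Measurable Tt := by unfold Tt; fun_prop

lemma Tt_pos : ∀ᵐ p ∂mu3, 0 < Tt p := by
  filter_upwards [mu3_pos] with p hp
  obtain ⟨h1, h2, h3⟩ := hp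
  unfold Tt
  positivity

lemma Qk_meas (w s : ℂ) : Measurable (Qk w s) := by
  have h1 := fs_meas w s
  have h2 := fs_meas (I*w) 0
  have h3 := ft_meas s
  unfold Qk
  fun_prop

lemma Tt_rpow (p : (ℝ × ℝ) × ℝ) (h1 : 0 < p.1.1) (h2 : 0 < p.1.2) (h3 : 0 < p.2) (r : ℝ) :
    Tt p ^ r = p.1.1 ^ (2*r) * p.1.2 ^ (-(2*r)) * p.2 ^ r := by
  unfold Tt
  rw [Real.div_rpow (by positivity) (by positivity), Real.mul_rpow h3.le (by positivity),
    ← Real.rpow_natCast, ← Real.rpow_natCast, ← Real.rpow_mul h1.le, ← Real.rpow_mul h2.le,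
    Real.rpow_neg h2.le]
  push_cast
  field_simp

lemma Qk_int_rpow (w s : ℂ) (r : ℝ) (h1 : -(s.re/2) < r) (h2 : r < 1/2) :
    Integrable (fun p => ‖Qk w s p‖ * Tt p ^ r) mu3 := by
  have i1 := fs_int_rpow w s (2*r) (by linarith)
  have i2 := fs_int_rpow (I*w) 0 (-(2*r)) (by simp; linarith)
  have i3 := ft_int_rpow s r (by linarith)
  have i := (i1.mul_prod i2).mul_prod i3
  refine i.congr ?_
  filter_upwards [mu3_pos] with p hp
  rw [Tt_rpow p hp.1 hp.2.1 hp.2.2]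
  simp only [Qk, norm_mul, norm_neg, Complex.norm_I]
  ring

/-- Integral of the kernel against a function of the theta variable. -/
def Jk (w s : ℂ) (g : ℝ → ℝ) : ℂ := ∫ p, Qk w s p * (g (Tt p) : ℂ) ∂mu3

lemma Jk_meas (w s : ℂ) (g : ℝ → ℝ) (hg : Measurable g) :
    Measurable (fun p => Qk w s p * (g (Tt p) : ℂ)) := by
  have := Qk_meas w s
  have := Tt_meas
  fun_prop

lemma Jk_le (w s : ℂ) (g : ℝ → ℝ) (c r : ℝ) (hb : ∀ T, 0 < T → |g T| ≤ c * T ^ r) :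
    ∀ᵐ p ∂mu3, ‖Qk w s p * (g (Tt p) : ℂ)‖ ≤ c * (‖Qk w s p‖ * Tt p ^ r) := by
  filter_upwards [Tt_pos] with p hp
  rw [norm_mul, Complex.norm_real, Real.norm_eq_abs]
  have := mul_le_mul_of_nonneg_left (hb _ hp) (norm_nonneg (Qk w s p))
  linarith

lemma Jk_integrable (w s : ℂ) (g : ℝ → ℝ) (hg : Measurable g) (c r : ℝ)
    (hb : ∀ T, 0 < T → |g T| ≤ c * T ^ r) (h1 : -(s.re/2) < r) (h2 : r < 1/2) :
    Integrable (fun p => Qk w s p * (g (Tt p) : ℂ)) mu3 :=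
  ((Qk_int_rpow w s r h1 h2).const_mul c).mono' (Jk_meas w s g hg).aestronglyMeasurable
    (Jk_le w s g c r hb)

lemma Jk_norm_le (w s : ℂ) (g : ℝ → ℝ) (c r : ℝ)
    (hb : ∀ T, 0 < T → |g T| ≤ c * T ^ r) (h1 : -(s.re/2) < r) (h2 : r < 1/2) :
    ∫ p, ‖Qk w s p * (g (Tt p) : ℂ)‖ ∂mu3 ≤ c * ∫ p, ‖Qk w s p‖ * Tt p ^ r ∂mu3 := by
  rw [← integral_const_mul]
  refine integral_mono_of_nonneg (Eventually.of_forall fun p => norm_nonneg _)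
    ((Qk_int_rpow w s r h1 h2).const_mul c) (Jk_le w s g c r hb)

lemma Jk_norm_le' (w s : ℂ) (g : ℝ → ℝ) (c r : ℝ)
    (hb : ∀ T, 0 < T → |g T| ≤ c * T ^ r) (h1 : -(s.re/2) < r) (h2 : r < 1/2) :
    ‖Jk w s g‖ ≤ c * ∫ p, ‖Qk w s p‖ * Tt p ^ r ∂mu3 :=
  (norm_integral_le_integral_norm _).trans (Jk_norm_le w s g c r hb h1 h2)

lemma Qk_norm_le (w : ℂ) (a b : ℝ) : ∀ᵐ p ∂mu3, ∀ s : ℂ, a ≤ s.re → s.re ≤ b →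
    ‖Qk w s p‖ ≤ ‖Qk w a p‖ + ‖Qk w b p‖ := by
  filter_upwards [mu3_pos] with p hp s ha hb
  obtain ⟨h1, h2, h3⟩ := hp
  have e : ∀ s : ℂ, ‖Qk w s p‖ = (p.1.1 ^ (-1:ℝ) * ‖cexp (-(p.1.1:ℂ)^2)‖ * ‖Complex.sinh (w * p.1.1)‖
      * ‖fs (I*w) 0 p.1.2‖ * p.2 ^ (-1:ℝ) * Real.exp (-p.2)) * (p.1.1 * p.2 ^ (1/2:ℝ)) ^ s.re := by
    intro s
    simp only [Qk, norm_mul, norm_neg, Complex.norm_I, norm_ft s _ h3]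
    rw [fs, norm_mul, norm_mul, Complex.norm_cpow_eq_rpow_re_of_pos h1, Complex.sub_re,
      Complex.one_re, sub_eq_add_neg, Real.rpow_add h1, sub_eq_add_neg, Real.rpow_add h3,
      Real.mul_rpow h1.le (by positivity), ← Real.rpow_mul h3.le,
      show 1/2 * s.re = s.re/2 by ring]
    ring
  rw [e s, e a, e b, ← mul_add, Complex.ofReal_re, Complex.ofReal_re]
  exact mul_le_mul_of_nonneg_left (rpow_le_add _ _ _ _ (by positivity) ha hb) (by positivity)

lemma Qk_diff (w : ℂ) : ∀ᵐ p ∂mu3, Differentiable ℂ (fun s => Qk w s p) := by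
  filter_upwards [mu3_pos] with p hp
  obtain ⟨h1, h2, h3⟩ := hp
  have h1' : (p.1.1:ℂ) ≠ 0 := by exact_mod_cast h1.ne'
  have h3' : (p.2:ℂ) ≠ 0 := by exact_mod_cast h3.ne'
  intro s
  unfold Qk fs ft
  have d1 : DifferentiableAt ℂ (fun s : ℂ => (p.1.1:ℂ)^(s-1)) s :=
    DifferentiableAt.const_cpow (by fun_prop) (Or.inl h1')
  have d2 : DifferentiableAt ℂ (fun s : ℂ => (p.2:ℂ)^(s/2-1)) s :=
    DifferentiableAt.const_cpow (by fun_prop) (Or.inl h3')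
  fun_prop

lemma Jk_diff (w : ℂ) (g : ℝ → ℝ) (hg : Measurable g) (c r : ℝ) (hc : 0 ≤ c)
    (hb : ∀ T, 0 < T → |g T| ≤ c * T ^ r) (h1 : 0 ≤ r) (h2 : r < 1/2) :
    DifferentiableOn ℂ (fun s => Jk w s g) {s : ℂ | 0 < s.re} := by
  unfold Jk
  refine differentiableOn_integral_param mu3 _ (isOpen_lt continuous_const Complex.continuous_re)
    _ (fun s _ => (Jk_meas w s g hg).aestronglyMeasurable) ?_ ?_
  · filter_upwards [Qk_diff w] with p hp
    exact (hp.mul_const _).differentiableOn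
  · intro s₀ hs₀
    have hs₀' : 0 < s₀.re := hs₀
    set ρ : ℝ := s₀.re / 2 with hρ
    refine ⟨ρ, by linarith, fun p => c * (‖Qk w (ρ:ℝ) p‖ * Tt p ^ r)
      + c * (‖Qk w ((3*ρ:ℝ)) p‖ * Tt p ^ r),
      ((Qk_int_rpow w _ r (by rw [Complex.ofReal_re]; linarith) h2).const_mul c).add
        ((Qk_int_rpow w _ r (by rw [Complex.ofReal_re]; linarith) h2).const_mul c), ?_⟩
    filter_upwards [Qk_norm_le w ρ (3*ρ), Tt_pos] with p hp hT s hs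
    have hd : |s.re - s₀.re| < ρ := by
      have := Complex.abs_re_le_norm (s - s₀)
      rw [Complex.sub_re] at this
      rw [Metric.mem_ball, dist_eq_norm] at hs
      linarith
    rw [abs_lt] at hd
    have hq := hp s (by linarith) (by linarith)
    rw [norm_mul, Complex.norm_real, Real.norm_eq_abs]
    have hTr : 0 ≤ Tt p ^ r := by positivity
    calc ‖Qk w s p‖ * |g (Tt p)| ≤ (‖Qk w (ρ:ℝ) p‖ + ‖Qk w ((3*ρ:ℝ)) p‖) * (c * Tt p ^ r) :=
          mul_le_mul hq (hb _ hT) (abs_nonneg _) (by positivity)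
      _ = _ := by ring

lemma Jk_one (w s : ℂ) (hs : 0 < s.re) :
    Jk w s (fun _ => 1) = -I * (Mf w s * Mf (I*w) 0) * Complex.Gamma (s/2) := by
  unfold Jk mu3 Qk
  rw [← ft_integral s hs, Mf, Mf]
  have e : ∀ p : (ℝ × ℝ) × ℝ, -I * (fs w s p.1.1 * fs (I * w) 0 p.1.2) * ft s p.2 * ((1:ℝ):ℂ)
     = -I * ((fs w s p.1.1 * fs (I * w) 0 p.1.2) * ft s p.2) := by intro p; push_cast; ring
  simp only [e]
  rw [integral_const_mul, integral_prod_mul (fun q : ℝ × ℝ => fs w s q.1 * fs (I * w) 0 q.2),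
    integral_prod_mul]
  ring

lemma Jk_half (w s : ℂ) (hs : 1 < s.re) :
    Jk w s (fun T => T ^ (-(1/2):ℝ))
      = -I * (Mf w (s-1) * Mf (I*w) 1) * Complex.Gamma ((s-1)/2) := by
  unfold Jk mu3 Qk
  rw [← ft_integral (s-1) (by simp; linarith), Mf, Mf]
  have e : ∀ᵐ p ∂mu3, -I * (fs w s p.1.1 * fs (I * w) 0 p.1.2) * ft s p.2
      * ((Tt p ^ (-(1/2):ℝ) : ℝ) : ℂ)
     = -I * ((fs w (s-1) p.1.1 * fs (I * w) 1 p.1.2) * ft (s-1) p.2) := by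
    filter_upwards [mu3_pos] with p hp
    obtain ⟨h1, h2, h3⟩ := hp
    have h1' : (p.1.1:ℂ) ≠ 0 := by exact_mod_cast h1.ne'
    have h2' : (p.1.2:ℂ) ≠ 0 := by exact_mod_cast h2.ne'
    have h3' : (p.2:ℂ) ≠ 0 := by exact_mod_cast h3.ne'
    rw [Tt_rpow p h1 h2 h3]
    push_cast
    rw [Complex.ofReal_cpow h1.le, Complex.ofReal_cpow h2.le, Complex.ofReal_cpow h3.le]
    simp only [fs, ft]
    rw [show s - 1 - 1 = (s - 1) + ((2 * -(1/2) : ℝ) : ℂ) by push_cast; ring,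
      show (1:ℂ) - 1 = (0 - 1) + ((-(2 * -(1/2)) : ℝ) : ℂ) by push_cast; ring,
      show (s-1)/2 - 1 = (s/2 - 1) + ((-(1/2) : ℝ) : ℂ) by push_cast; ring,
      Complex.cpow_add _ _ h1', Complex.cpow_add _ _ h2', Complex.cpow_add _ _ h3']
    ring
  unfold mu3 at e
  rw [integral_congr_ae e, integral_const_mul,
    integral_prod_mul (fun q : ℝ × ℝ => fs w (s-1) q.1 * fs (I * w) 1 q.2),
    integral_prod_mul]
  ring


/-- Two-variable integrand. -/
def okI (w s : ℂ) (y x : ℝ) (q : ℝ × ℝ) : ℂ :=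
  ((q.1 * q.2 : ℝ) : ℂ) ^ (s - 1) * Complex.exp (-((q.1:ℂ) ^ 2 + (q.2:ℂ) ^ 2)) *
        Complex.sin (w * q.2) * Complex.sinh (w * q.1) /
        (((y:ℂ) ^ 2 * (q.1:ℂ) ^ 2 + (x:ℂ) ^ 2 * (q.2:ℂ) ^ 2)) ^ (s / 2)

lemma ok_tau (w s : ℂ) (hs : 0 < s.re) (y x u v : ℝ) (hy : 0 < y) (hx : 0 < x) (hu : 0 < u)
    (hv : 0 < v) :
    ∫ t, Qk w s ((u, v), t) * ((Real.exp (-(y^2 * Tt ((u,v),t) / x^2)) : ℝ) : ℂ) ∂mup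
      = Complex.Gamma (s/2) * (x:ℂ)^s * okI w s y x (u, v) := by
  have hs2 : 0 < (s/2).re := by simp [hs]
  set N : ℝ := y^2*u^2 + x^2*v^2 with hN
  have hN0 : 0 < N := by positivity
  set r : ℝ := N / (x^2*v^2) with hr
  have hr0 : 0 < r := by positivity
  have key := integral_cpow_mul_exp_neg_mul_Ioi (a := s/2) (r := r) hs2 hr0
  have e : ∀ t : ℝ, Qk w s ((u, v), t) * ((Real.exp (-(y^2 * Tt ((u,v),t) / x^2)) : ℝ) : ℂ)
      = (-I * (fs w s u * fs (I * w) 0 v)) * ((t:ℂ)^(s/2-1) * cexp (-((r:ℂ) * t))) := by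
    intro t
    simp only [Qk, ft, Tt]
    have : cexp (-((r:ℂ)*t)) = cexp (-(t:ℂ)) * ((Real.exp (-(y^2 * (t * u^2/v^2) / x^2)) : ℝ) : ℂ) := by
      rw [Complex.ofReal_exp, ← Complex.exp_add]
      congr 1
      rw [hr, hN]
      have : (x:ℂ) ≠ 0 := by exact_mod_cast hx.ne'
      have : (v:ℂ) ≠ 0 := by exact_mod_cast hv.ne'
      push_cast
      field_simp
      ring
    rw [this]; ring
  simp only [e]
  rw [integral_const_mul]
  unfold mup
  rw [key]
  have e1 : ((1:ℂ)/r)^(s/2) = (x:ℂ)^s * (v:ℂ)^s / (N:ℂ)^(s/2) := by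
    rw [show (1:ℂ)/r = ((1/r:ℝ):ℂ) by push_cast; rfl, cpe _ (by positivity), cpe x hx, cpe v hv,
      cpe N hN0, ← Complex.exp_add, ← Complex.exp_sub]
    congr 1
    have : Real.log (1/r) = 2 * Real.log x + 2 * Real.log v - Real.log N := by
      rw [hr, one_div_div, Real.log_div (by positivity) (by positivity),
        Real.log_mul (by positivity) (by positivity), Real.log_pow, Real.log_pow]
      push_cast; ring
    rw [this]; push_cast; ring
  have e2 : (((y:ℂ) ^ 2 * (u:ℂ) ^ 2 + (x:ℂ) ^ 2 * (v:ℂ) ^ 2)) = (N:ℂ) := by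
    rw [hN]; push_cast; ring
  have e3 : Complex.sinh (I * w * v) = I * Complex.sin (w * v) := by
    rw [show I * w * v = (w * v) * I by ring, Complex.sinh_mul_I]; ring
  have e4 : ((u * v : ℝ) : ℂ) ^ (s - 1) = (u:ℂ)^(s-1) * (v:ℂ)^(s-1) := by
    rw [Complex.ofReal_mul, Complex.mul_cpow_ofReal_nonneg hu.le hv.le]
  have e5 : (v:ℂ)^((0:ℂ)-1) * (v:ℂ)^s = (v:ℂ)^(s-1) := by
    rw [← Complex.cpow_add _ _ (by exact_mod_cast hv.ne')]; congr 1; ring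
  simp only [okI, fs]
  rw [e1, e2, e3, e4, ← e5, show -((u:ℂ)^2 + (v:ℂ)^2) = -(u:ℂ)^2 + -(v:ℂ)^2 by ring,
    Complex.exp_add]
  linear_combination (-((u:ℂ)^(s-1) * cexp (-(u:ℂ)^2) * Complex.sinh (w*u) * (v:ℂ)^((0:ℂ)-1)
    * cexp (-(v:ℂ)^2) * Complex.sin (w*v) * (x:ℂ)^s * (v:ℂ)^s / (N:ℂ)^(s/2) * Complex.Gamma (s/2)))
    * Complex.I_sq

lemma expT_bound (c : ℝ) (hc : 0 < c) (p : ℝ) (h0 : 0 ≤ p) (h1 : p ≤ 1) (T : ℝ) (hT : 0 < T) :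
    |Real.exp (-(c*T))| ≤ c^(-p) * T^(-p) := by
  rw [abs_of_pos (Real.exp_pos _), ← Real.mul_rpow hc.le hT.le]
  exact exp_neg_le_rpow _ _ (by positivity) h0 h1

/-- The exponential test function. -/
def ge (y x : ℝ) (T : ℝ) : ℝ := Real.exp (-(y^2 * T / x^2))

lemma ge_meas (y x : ℝ) : Measurable (ge y x) := by unfold ge; fun_prop

lemma ge_bound (y x : ℝ) (hy : 0 < y) (hx : 0 < x) (p : ℝ) (h0 : 0 ≤ p) (h1 : p ≤ 1) (T : ℝ)
    (hT : 0 < T) : |ge y x T| ≤ (y^(-(2*p)) * x^(2*p)) * T^(-p) := by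
  have := expT_bound (y^2/x^2) (by positivity) p h0 h1 T hT
  unfold ge
  rw [show y^2*T/x^2 = y^2/x^2*T by ring]
  refine this.trans (le_of_eq ?_)
  congr 1
  rw [Real.div_rpow (by positivity) (by positivity), ← Real.rpow_natCast, ← Real.rpow_natCast,
    ← Real.rpow_mul hx.le, ← Real.rpow_mul hy.le, div_eq_mul_inv, ← Real.rpow_neg hx.le]
  push_cast
  ring_nf

/-- The two-variable integral. -/
def origK (w s : ℂ) (y x : ℝ) : ℂ :=
  ∫ u in Ioi (0:ℝ), ∫ v in Ioi (0:ℝ), okI w s y x (u, v)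

lemma ge_integrable (w s : ℂ) (hs : 0 < s.re) (y x : ℝ) :
    Integrable (fun p => Qk w s p * (ge y x (Tt p) : ℂ)) mu3 := by
  refine Jk_integrable w s _ (ge_meas y x) 1 0 ?_ (by linarith) (by norm_num)
  intro T hT
  rw [ge, abs_of_pos (Real.exp_pos _), Real.rpow_zero, mul_one, Real.exp_le_one_iff]
  have : 0 ≤ y^2*T/x^2 := by positivity
  linarith

lemma okI_integrable (w s : ℂ) (hs : 0 < s.re) (y x : ℝ) (hy : 0 < y) (hx : 0 < x) :
    Integrable (okI w s y x) (mup.prod mup) := by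
  have h := (ge_integrable w s hs y x).integral_prod_left
  have hG : Complex.Gamma (s/2) ≠ 0 := Complex.Gamma_ne_zero_of_re_pos (by simp [hs])
  have hxs : (x:ℂ)^s ≠ 0 := by
    rw [cpe x hx]; exact Complex.exp_ne_zero _
  refine (h.const_mul (Complex.Gamma (s/2) * (x:ℂ)^s)⁻¹).congr ?_
  filter_upwards [mu2_pos] with q hq
  have := ok_tau w s hs y x q.1 q.2 hy hx hq.1 hq.2
  simp only [Prod.mk.eta] at this
  simp only [ge]
  rw [this]
  field_simp

lemma origK_eq (w s : ℂ) (hs : 0 < s.re) (y x : ℝ) (hy : 0 < y) (hx : 0 < x) :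
    Complex.Gamma (s/2) * (x:ℂ)^s * origK w s y x = Jk w s (ge y x) := by
  have h := integral_prod _ (ge_integrable w s hs y x)
  unfold Jk mu3
  have h2 := integral_prod _ (okI_integrable w s hs y x hy hx)
  rw [h]
  change _ * ∫ u, ∫ v, okI w s y x (u, v) ∂mup ∂mup = _
  rw [← h2, ← integral_const_mul]
  refine integral_congr_ae ?_
  filter_upwards [mu2_pos] with q hq
  have := ok_tau w s hs y x q.1 q.2 hy hx hq.1 hq.2
  simp only [Prod.mk.eta] at this
  simp only [ge]
  rw [this]

lemma okI_swap (w s : ℂ) (y x u v : ℝ) : okI (I*w) s y x (u,v) = - okI w s x y (v,u) := by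
  simp only [okI]
  rw [show I * w * v = (w * v) * I by ring, show I * w * u = (w*u) * I by ring,
    Complex.sinh_mul_I, Complex.sin_mul_I, mul_comm u v, add_comm ((v:ℂ)^2),
    add_comm ((x:ℂ)^2 * (v:ℂ)^2)]
  ring_nf
  rw [Complex.I_sq]
  ring

lemma origK_swap (w s : ℂ) (hs : 0 < s.re) (y x : ℝ) (hy : 0 < y) (hx : 0 < x) :
    origK (I*w) s y x = - origK w s x y := by
  unfold origK
  simp only [okI_swap, integral_neg]
  congr 1
  exact (integral_integral_swap (μ := mup) (ν := mup) (f := fun u v => okI w s x y (u, v))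
    (okI_integrable w s hs x y hx hy)).symm

lemma origK_smul (w s : ℂ) (c y x : ℝ) (hc : 0 < c) (hy : 0 < y) (hx : 0 < x) :
    origK w s (c*y) (c*x) = (c:ℂ)^(-s) * origK w s y x := by
  unfold origK
  rw [← integral_const_mul]
  refine setIntegral_congr_fun measurableSet_Ioi fun u hu => ?_
  rw [← integral_const_mul]
  refine setIntegral_congr_fun measurableSet_Ioi fun v hv => ?_
  have hu : 0 < u := hu
  have hv : 0 < v := hv
  simp only [okI]
  set N : ℝ := y^2*u^2 + x^2*v^2 with hN
  have hN0 : 0 < N := by positivity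
  have e1 : ((((c*y:ℝ):ℂ)) ^ 2 * (u:ℂ) ^ 2 + (((c*x:ℝ):ℂ)) ^ 2 * (v:ℂ) ^ 2)^(s/2)
     = (c:ℂ)^s * (N:ℂ)^(s/2) := by
    rw [show ((((c*y:ℝ):ℂ)) ^ 2 * (u:ℂ) ^ 2 + (((c*x:ℝ):ℂ)) ^ 2 * (v:ℂ) ^ 2)
      = ((c^2*N:ℝ):ℂ) by rw [hN]; push_cast; ring, cpe _ (by positivity), cpe c hc, cpe N hN0,
      ← Complex.exp_add, Real.log_mul (by positivity) (by positivity), Real.log_pow]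
    congr 1; push_cast; ring
  have e2 : (((y:ℂ) ^ 2 * (u:ℂ) ^ 2 + (x:ℂ) ^ 2 * (v:ℂ) ^ 2)) = (N:ℂ) := by
    rw [hN]; push_cast; ring
  rw [e1, e2, Complex.cpow_neg]
  have : (c:ℂ)^s ≠ 0 := by rw [cpe c hc]; exact Complex.exp_ne_zero _
  have : (N:ℂ)^(s/2) ≠ 0 := by rw [cpe N hN0]; exact Complex.exp_ne_zero _
  field_simp


/-- Normalising constant. -/
def Cc (w s : ℂ) : ℂ := 4 / (w ^ 2 * (Real.sqrt Real.pi : ℂ) * Complex.Gamma ((s + 1) / 2))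

lemma zetaW_eq (w s : ℂ) (x : ℝ) :
    zetaW w s (x+1) = Cc w s * ∑' n : ℕ+, origK w s (n:ℝ) x := by
  unfold zetaW Cc origK okI
  congr 1
  refine tsum_congr fun n => ?_
  simp only [Complex.ofReal_add, Complex.ofReal_one, add_sub_cancel_right, Complex.ofReal_natCast]

lemma cpow_pos_ne (x : ℝ) (hx : 0 < x) (s : ℂ) : (x:ℂ)^s ≠ 0 := by
  rw [cpe x hx]; exact Complex.exp_ne_zero _

lemma origK_norm_le (w s : ℂ) (hs : 0 < s.re) (y x : ℝ) (hy : 0 < y) (hx : 0 < x)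
    (p : ℝ) (h0 : 0 ≤ p) (h1 : p ≤ 1) (h2 : p < s.re/2) :
    ‖origK w s y x‖ ≤ ((∫ q, ‖Qk w s q‖ * Tt q ^ (-p) ∂mu3) / ‖Complex.Gamma (s/2)‖)
      * (y^(-(2*p)) * x^(2*p - s.re)) := by
  have hG : Complex.Gamma (s/2) ≠ 0 := Complex.Gamma_ne_zero_of_re_pos (by simp [hs])
  have hG' : 0 < ‖Complex.Gamma (s/2)‖ := norm_pos_iff.2 hG
  have h := Jk_norm_le' w s (ge y x) _ (-p) (ge_bound y x hy hx p h0 h1) (by linarith) (by linarith)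
  rw [← origK_eq w s hs y x hy hx, norm_mul, norm_mul,
    Complex.norm_cpow_eq_rpow_re_of_pos hx] at h
  rw [Real.rpow_sub hx]
  have hxs : 0 < x ^ s.re := by positivity
  rw [show ∀ a b c d e : ℝ, a / b * (c * (d / e)) = (c * d * a) / (b * e) by intros; field_simp,
    le_div_iff₀ (by positivity)]
  linarith

lemma exists_p (σ : ℝ) (h : 1 < σ) : ∃ p : ℝ, 1/2 < p ∧ p ≤ 1 ∧ p < σ/2 := by
  obtain ⟨p, h1, h2⟩ := exists_between (show (1/2:ℝ) < min (σ/2) 1 by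
    rw [lt_min_iff]; constructor <;> linarith)
  rw [lt_min_iff] at h2
  exact ⟨p, h1, h2.2.le, h2.1⟩

lemma pnat_pos_real (n : ℕ+) : (0:ℝ) < (n:ℝ) := by exact_mod_cast n.pos

lemma origK_summable (w s : ℂ) (hs : 1 < s.re) (x : ℝ) (hx : 0 < x) :
    Summable (fun n : ℕ+ => origK w s (n:ℝ) x) := by
  obtain ⟨p, h1, h2, h3⟩ := exists_p s.re hs
  refine Summable.of_norm_bounded (g := fun n : ℕ+ =>
    ((∫ q, ‖Qk w s q‖ * Tt q ^ (-p) ∂mu3) / ‖Complex.Gamma (s/2)‖)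
      * ((n:ℝ)^(-(2*p)) * x^(2*p - s.re))) ?_ ?_
  · exact ((summable_pnat_rpow (2*p) (by linarith)).mul_right _).mul_left _
  · intro n
    exact origK_norm_le w s (by linarith) _ x (pnat_pos_real n) hx p (by linarith) h2 h3

/-- The theta remainder at scale `x`. -/
def Hx (x T : ℝ) : ℝ := Hth (T / x^2)

lemma Hx_meas (x : ℝ) : Measurable (Hx x) := by
  unfold Hx
  exact Hth_measurable.comp (by fun_prop)

lemma Hx_bound (a : ℝ) (h0 : 0 < a) (h1 : a < 1) : ∃ c, 0 ≤ c ∧ ∀ x, 0 < x → ∀ T, 0 < T →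
    |Hx x T| ≤ (c * x^(-a)) * T^(a/2) := by
  obtain ⟨c, hc, h⟩ := Hth_bound a h0 h1
  refine ⟨c, hc, fun x hx T hT => ?_⟩
  unfold Hx
  rw [abs_of_nonneg (Hth_nonneg _)]
  refine (h _ (by positivity)).trans (le_of_eq ?_)
  rw [Real.div_rpow hT.le (by positivity), ← Real.rpow_natCast, ← Real.rpow_mul hx.le,
    Real.rpow_neg hx.le]
  push_cast
  rw [show 2 * (a/2) = a by ring]
  field_simp

lemma tsum_ge (x T : ℝ) (hx : 0 < x) (hT : 0 < T) :
    ∑' n : ℕ+, ge (n:ℝ) x T = (Real.sqrt Real.pi * x / 2) * T ^ (-(1/2):ℝ) - 1/2 + Hx x T / 2 := by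
  have h := theta_eq (T/x^2) (by positivity)
  unfold ge Hx
  simp only [← mul_div_assoc] at h
  rw [h]
  congr 2
  rw [Real.sqrt_div' _ (by positivity), Real.sqrt_div' _ (by positivity), Real.sqrt_sq hx.le,
    Real.rpow_neg hT.le, ← Real.sqrt_eq_rpow]
  have := Real.sqrt_pos.2 hT
  field_simp

lemma tsum_Jk (w s : ℂ) (hs : 1 < s.re) (x : ℝ) (hx : 0 < x) :
    ∑' n : ℕ+, Jk w s (ge (n:ℝ) x) = (Real.sqrt Real.pi * x / 2 : ℝ) * Jk w s (fun T => T ^ (-(1/2):ℝ))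
      - 1/2 * Jk w s (fun _ => 1) + 1/2 * Jk w s (Hx x) := by
  obtain ⟨p, h1, h2, h3⟩ := exists_p s.re hs
  have hs0 : 0 < s.re := by linarith
  have hsum := hasSum_integral_of_summable_integral_norm (μ := mu3)
    (F := fun (n : ℕ+) q => Qk w s q * (ge (n:ℝ) x (Tt q) : ℂ))
    (fun n => ge_integrable w s hs0 n x) (by
      refine Summable.of_nonneg_of_le (fun n => integral_nonneg fun q => norm_nonneg _)
        (fun n => Jk_norm_le w s (ge n x) _ (-p) (ge_bound n x (pnat_pos_real n) hx p
          (by linarith) h2) (by linarith) (by linarith)) ?_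
      exact ((summable_pnat_rpow (2*p) (by linarith)).mul_right _).mul_right _)
  have e0 := hsum.tsum_eq
  have i1 : Integrable (fun q => Qk w s q * (((fun T : ℝ => T ^ (-(1/2):ℝ)) (Tt q) : ℝ) : ℂ)) mu3 :=
    Jk_integrable w s (fun T : ℝ => T ^ (-(1/2):ℝ)) (by fun_prop) 1 (-(1/2)) (fun T hT => by
      rw [abs_of_pos (by positivity), one_mul]) (by linarith) (by norm_num)
  have i2 : Integrable (fun q => Qk w s q * (((fun _ : ℝ => (1:ℝ)) (Tt q) : ℝ) : ℂ)) mu3 :=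
    Jk_integrable w s (fun _ : ℝ => (1:ℝ)) (by fun_prop) 1 0 (fun T hT => by simp) (by linarith) (by norm_num)
  obtain ⟨c, hc, hb⟩ := Hx_bound (1/2) (by norm_num) (by norm_num)
  have i3 : Integrable (fun q => Qk w s q * ((Hx x (Tt q) : ℝ) : ℂ)) mu3 :=
    Jk_integrable w s _ (Hx_meas x) _ _ (hb x hx) (by linarith) (by norm_num)
  unfold Jk
  rw [e0, ← integral_const_mul, ← integral_const_mul, ← integral_const_mul,
    ← integral_sub (i1.const_mul _) (i2.const_mul _)]
  refine Eq.trans ?_ (integral_add ((i1.const_mul _).sub (i2.const_mul _)) (i3.const_mul _))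
  refine integral_congr_ae ?_
  filter_upwards [Tt_pos] with q hq
  rw [tsum_mul_left, ← Complex.ofReal_tsum, tsum_ge x _ hx hq]
  push_cast
  ring

lemma Afun_I (w z : ℂ) (hw : w ≠ 0) : Afun (I * (I * w)) z = Afun w z := by
  have hI : I * (I * w) ≠ 0 := by simp [hw]
  rw [Afun_eq _ _ hI, Afun_eq _ _ hw, show (I * (I * w))^2 = w^2 by
    rw [← mul_assoc, Complex.I_mul_I]; ring]

lemma gamma_half : Complex.Gamma (1/2) = (Real.sqrt Real.pi : ℂ) := by
  rw [Complex.Gamma_one_half_eq, Real.sqrt_eq_rpow, Complex.ofReal_cpow Real.pi_pos.le]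
  push_cast; rfl

lemma sqrtpi_ne : (Real.sqrt Real.pi : ℂ) ≠ 0 := by
  have := Real.sqrt_pos.2 Real.pi_pos
  exact_mod_cast this.ne'

lemma gamma_pos_ne (s : ℂ) (hs : 0 < s.re) : Complex.Gamma (s/2) ≠ 0 :=
  Complex.Gamma_ne_zero_of_re_pos (by simp [hs])

lemma main_one (w s : ℂ) (hw : w ≠ 0) (hs : 0 < s.re) :
    Cc w s / Complex.Gamma (s/2) * Jk w s (fun _ => 1) = Afun w (s-1) := by
  have g1 := gamma_pos_ne s hs
  have g2 := gamma_pos_ne (s+1) (by simp; linarith)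
  rw [Jk_one w s hs, Mf_eq w s (by linarith), Mf_eq (I*w) 0 (by simp), Afun_eq w _ hw, zero_add,
    gamma_half, Cc, show (I*w)^2/4 = -(w^2/4) by rw [mul_pow, Complex.I_sq]; ring,
    show 1 + (s-1)/2 = (s+1)/2 by ring]
  have := sqrtpi_ne
  field_simp
  rw [Complex.I_sq]
  ring

lemma main_half (w s : ℂ) (hw : w ≠ 0) (hs : 1 < s.re) :
    Cc w s / Complex.Gamma (s/2) * ((Real.sqrt Real.pi : ℂ)/2 * Jk w s (fun T => T ^ (-(1/2):ℝ)))
      = Afun (I*w) (-(s-1)) / (s-1) := by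
  have g1 := gamma_pos_ne s (by linarith)
  have g3 := gamma_pos_ne (s-1) (by simp; linarith)
  have hs1 : s - 1 ≠ 0 := by
    intro h; rw [sub_eq_zero] at h; rw [h] at hs; simp at hs
  have hI : I * w ≠ 0 := by simp [hw]
  have hrec : Complex.Gamma ((s+1)/2) = (s-1)/2 * Complex.Gamma ((s-1)/2) := by
    rw [← Complex.Gamma_add_one _ (by simpa using hs1)]
    congr 1; ring
  rw [Jk_half w s hs, Mf_eq w (s-1) (by simp; linarith), Mf_eq (I*w) 1 (by simp), Afun_eq' _ _ hI,
    Cc, hrec, show -((I*w)^2/4) = w^2/4 by rw [mul_pow, Complex.I_sq]; ring,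
    show ((1:ℂ)+1)/2 = 1 by norm_num, Complex.Gamma_one, show (s-1+1)/2 = s/2 by ring,
    show (1 - -(s-1))/2 = s/2 by ring]
  have := sqrtpi_ne
  field_simp
  rw [Complex.I_sq]
  ring

/-- The remainder. -/
def Rk (w s : ℂ) (x : ℝ) : ℂ := 1/2 * (Cc w s / Complex.Gamma (s/2)) * (x:ℂ)^(-s) * Jk w s (Hx x)

lemma sum_origK (w s : ℂ) (hw : w ≠ 0) (hs : 1 < s.re) (x : ℝ) (hx : 0 < x) :
    Cc w s * ∑' n : ℕ+, origK w s (n:ℝ) x = Afun (I*w) (-(s-1)) * (x:ℂ)^(-(s-1)) / (s-1)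
      - Afun w (s-1) * (x:ℂ)^(-(s-1)-1) / 2 + Rk w s x := by
  have g1 := gamma_pos_ne s (by linarith)
  have hxs := cpow_pos_ne x hx s
  have h := tsum_Jk w s hs x hx
  have e : ∀ n : ℕ+, Jk w s (ge (n:ℝ) x) = Complex.Gamma (s/2) * (x:ℂ)^s * origK w s n x :=
    fun n => (origK_eq w s (by linarith) n x (pnat_pos_real n) hx).symm
  simp only [e] at h
  rw [tsum_mul_left] at h
  have h1 := main_one w s hw (by linarith)
  have h2 := main_half w s hw hs
  set S := ∑' n : ℕ+, origK w s (n:ℝ) x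
  have hS : S = (x:ℂ)^(-s) / Complex.Gamma (s/2) * (Complex.Gamma (s/2) * (x:ℂ)^s * S) := by
    rw [Complex.cpow_neg]; field_simp
  have hx1 : (x:ℂ)^(-(s-1)) = (x:ℂ)^(-s) * x := by
    rw [show -(s-1) = -s + 1 by ring, Complex.cpow_add _ _ (by exact_mod_cast hx.ne'),
      Complex.cpow_one]
  rw [hS, h, show -(s-1)-1 = -s by ring, hx1,
    show ∀ a b c : ℂ, a * b / c = a / c * b by intros; ring, ← h2, ← h1, Rk]
  push_cast
  ring

lemma zetaW_main (w s : ℂ) (hw : w ≠ 0) (hs : 1 < s.re) (x : ℝ) (hx : 0 < x) :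
    zetaW w s (x+1) = Afun (I*w) (-(s-1)) * (x:ℂ)^(-(s-1)) / (s-1)
      - Afun w (s-1) * (x:ℂ)^(-(s-1)-1) / 2 + Rk w s x := by
  rw [zetaW_eq, sum_origK w s hw hs x hx]


lemma oneF1_diff (w : ℂ) (hw : w ≠ 0) :
    DifferentiableOn ℂ (fun p => oneF1 ((p+1)/2) (3/2) (w^2/4)) {p : ℂ | -1 < p.re} := by
  have hG : Differentiable ℂ (fun p : ℂ => (Complex.Gamma ((p+1)/2))⁻¹) :=
    Complex.differentiable_one_div_Gamma.comp (by fun_prop)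
  refine (((Mf_diff w).mul hG.differentiableOn).const_mul (2/w)).congr fun p hp => ?_
  have hp : -1 < p.re := hp
  have := gamma_pos_ne (p+1) (by simp; linarith)
  simp only [Pi.mul_apply]
  rw [Mf_eq w p hp]
  field_simp

lemma Afun_diff1 (w : ℂ) (hw : w ≠ 0) :
    DifferentiableOn ℂ (fun s => Afun w (s-1)) {s : ℂ | 0 < s.re} := by
  refine (((oneF1_diff w hw).mono fun s (hs : 0 < s.re) =>
    (show -1 < s.re by linarith)).const_mul (oneF1 (1/2) (3/2) (-(w^2/4)))).congr fun s hs => ?_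
  rw [Afun_eq w _ hw, show 1 + (s-1)/2 = (s+1)/2 by ring]

lemma Afun_diff2 (w : ℂ) (hw : w ≠ 0) :
    DifferentiableOn ℂ (fun s => Afun w (-(s-1))) {s : ℂ | 0 < s.re} := by
  have hI : I * w ≠ 0 := by simp [hw]
  have h : DifferentiableOn ℂ (fun s : ℂ => oneF1 ((s-1+1)/2) (3/2) ((I*w)^2/4)) {s : ℂ | 0 < s.re} :=
    (oneF1_diff (I*w) hI).comp (f := fun s : ℂ => s - 1) (by fun_prop) (fun s hs => by
      have hs : 0 < s.re := hs
      show -1 < (s-1).re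
      simp; linarith)
  refine (h.const_mul (oneF1 1 (3/2) (w^2/4))).congr fun s hs => ?_
  rw [Afun_eq' w _ hw, show (I*w)^2/4 = -(w^2/4) by rw [mul_pow, Complex.I_sq]; ring,
    show (1 - -(s-1))/2 = (s-1+1)/2 by ring]

lemma cpow_diff (x : ℝ) (hx : 0 < x) (f : ℂ → ℂ) (hf : Differentiable ℂ f) :
    Differentiable ℂ (fun s => (x:ℂ)^(f s)) := fun s =>
  DifferentiableAt.const_cpow (hf s) (Or.inl (by exact_mod_cast hx.ne'))

lemma pre_diff (w : ℂ) :
    Differentiable ℂ (fun s => 1/2 * (Cc w s / Complex.Gamma (s/2))) := by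
  have h1 : Differentiable ℂ (fun p : ℂ => (Complex.Gamma ((p+1)/2))⁻¹) :=
    Complex.differentiable_one_div_Gamma.comp (by fun_prop)
  have h2 : Differentiable ℂ (fun p : ℂ => (Complex.Gamma (p/2))⁻¹) :=
    Complex.differentiable_one_div_Gamma.comp (by fun_prop)
  have e : (fun s => 1/2 * (Cc w s / Complex.Gamma (s/2))) = fun s =>
      (2 / (w^2 * (Real.sqrt Real.pi : ℂ))) * ((Complex.Gamma ((s+1)/2))⁻¹ * (Complex.Gamma (s/2))⁻¹) := by
    funext s
    rw [Cc]
    simp only [div_eq_mul_inv, mul_inv]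
    ring
  rw [e]
  exact (h1.mul h2).const_mul _

lemma JkH_diff (w : ℂ) (x : ℝ) (hx : 0 < x) :
    DifferentiableOn ℂ (fun s => Jk w s (Hx x)) {s : ℂ | 0 < s.re} := by
  obtain ⟨c, hc, hb⟩ := Hx_bound (1/2) (by norm_num) (by norm_num)
  exact Jk_diff w (Hx x) (Hx_meas x) _ _ (by positivity) (hb x hx) (by norm_num) (by norm_num)

lemma Rk_diff (w : ℂ) (x : ℝ) (hx : 0 < x) :
    DifferentiableOn ℂ (fun s => Rk w s x) {s : ℂ | 0 < s.re} := by
  have h1 := (pre_diff w).differentiableOn (s := {s : ℂ | 0 < s.re})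
  have h2 := (cpow_diff x hx (fun s => -s) (by fun_prop)).differentiableOn (s := {s : ℂ | 0 < s.re})
  exact (h1.mul h2).mul (JkH_diff w x hx)

lemma phi_eq (w : ℂ) (hw : w ≠ 0) (x : ℝ) (hx : 0 < x) (F : ℂ → ℂ)
    (hF : DifferentiableOn ℂ F {s : ℂ | -1 < s.re ∧ s ≠ 1})
    (hFeq : ∀ s : ℂ, 1 < s.re → F s = zetaW w s (x+1)) (s : ℂ) (hs : 0 < s.re) (hs1 : s ≠ 1) :
    F s + Afun w (s-1) * (x:ℂ)^(-(s-1)-1) / 2 - Afun (I*w) (-(s-1)) * (x:ℂ)^(-(s-1)) / (s-1)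
      = Rk w s x := by
  have hI : I * w ≠ 0 := by simp [hw]
  refine eqOn_halfplane {1} (finite_singleton _) (fun s => F s + Afun w (s-1) * (x:ℂ)^(-(s-1)-1) / 2
    - Afun (I*w) (-(s-1)) * (x:ℂ)^(-(s-1)) / (s-1)) (fun s => Rk w s x) 1 zero_le_one ?_ ?_ ?_ s hs hs1
  · set U := ({s : ℂ | 0 < s.re} \ {1})
    have hU : U ⊆ {s : ℂ | 0 < s.re} := sdiff_subset
    have d0 : DifferentiableOn ℂ F U := hF.mono fun s h => ⟨by
      have : 0 < s.re := h.1
      linarith, h.2⟩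
    have d1 := (Afun_diff1 w hw).mono hU
    have d2 := (Afun_diff2 (I*w) hI).mono hU
    have c1 := (cpow_diff x hx (fun s => -(s-1)-1) (by fun_prop)).differentiableOn (s := U)
    have c2 := (cpow_diff x hx (fun s => -(s-1)) (by fun_prop)).differentiableOn (s := U)
    refine (d0.add ((d1.mul c1).div_const 2)).sub ((d2.mul c2).div (by fun_prop) fun s h => ?_)
    exact sub_ne_zero.2 h.2
  · exact (Rk_diff w x hx).mono sdiff_subset
  · intro s hs _
    rw [hFeq s hs, zetaW_main w s hw hs x hx]
    ring

/-- Reduced summand. -/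
def Rb (w s : ℂ) (α : ℝ) (m : ℕ+) : ℂ := (m:ℂ)^(-s) * Jk w s (Hx (m*α))

lemma Rk_Rb (w s : ℂ) (α : ℝ) (hα : 0 < α) (m : ℕ+) :
    Rk w s (m*α) = (1/2 * (Cc w s / Complex.Gamma (s/2)) * (α:ℂ)^(-s)) * Rb w s α m := by
  rw [Rk, Rb, Complex.ofReal_mul, Complex.mul_cpow_ofReal_nonneg (pnat_pos_real m).le hα.le,
    Complex.ofReal_natCast]
  ring

lemma JkH_norm_le (w : ℂ) (b1 b2 a : ℝ) (hb : 0 < b1) (h12 : b1 ≤ b2) (ha : 0 < a) (ha1 : a < 1) :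
    ∃ B, 0 ≤ B ∧ ∀ x, 0 < x → ∀ s : ℂ, b1 ≤ s.re → s.re ≤ b2 → ‖Jk w s (Hx x)‖ ≤ B * x^(-a) := by
  obtain ⟨c, hc, hH⟩ := Hx_bound a ha ha1
  have i1 := Qk_int_rpow w (b1:ℝ) (a/2) (by rw [Complex.ofReal_re]; linarith) (by linarith)
  have i2 := Qk_int_rpow w (b2:ℝ) (a/2) (by rw [Complex.ofReal_re]; linarith) (by linarith)
  have hnn : ∀ s, 0 ≤ ∫ q, ‖Qk w s q‖ * Tt q ^ (a/2) ∂mu3 := fun s => by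
    refine integral_nonneg_of_ae ?_
    filter_upwards [Tt_pos] with q hq
    positivity
  refine ⟨c * ((∫ q, ‖Qk w (b1:ℝ) q‖ * Tt q ^ (a/2) ∂mu3)
    + ∫ q, ‖Qk w (b2:ℝ) q‖ * Tt q ^ (a/2) ∂mu3), mul_nonneg hc (add_nonneg (hnn _) (hnn _)),
    fun x hx s h1 h2 => ?_⟩
  have hle : ∫ q, ‖Qk w s q‖ * Tt q ^ (a/2) ∂mu3 ≤ (∫ q, ‖Qk w (b1:ℝ) q‖ * Tt q ^ (a/2) ∂mu3)
    + ∫ q, ‖Qk w (b2:ℝ) q‖ * Tt q ^ (a/2) ∂mu3 := by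
    rw [← integral_add i1 i2]
    refine integral_mono_ae (Qk_int_rpow w s (a/2) (by linarith) (by linarith)) (i1.add i2) ?_
    filter_upwards [Qk_norm_le w b1 b2, Tt_pos] with q hq hT
    have := mul_le_mul_of_nonneg_right (hq s h1 h2) (show 0 ≤ Tt q ^ (a/2) by positivity)
    linarith
  refine (Jk_norm_le' w s (Hx x) _ _ (hH x hx) (by linarith) (by linarith)).trans ?_
  have hx' : 0 ≤ c * x^(-a) := by positivity
  calc c * x^(-a) * ∫ q, ‖Qk w s q‖ * Tt q ^ (a/2) ∂mu3 ≤ c * x^(-a) * _ :=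
        mul_le_mul_of_nonneg_left hle hx'
    _ = _ := by ring

lemma Rb_diff (w : ℂ) (α : ℝ) (hα : 0 < α) :
    DifferentiableOn ℂ (fun s => ∑' m : ℕ+, Rb w s α m) {s : ℂ | 0 < s.re} := by
  intro s₀ hs₀
  have hs₀ : 0 < s₀.re := hs₀
  set b1 := s₀.re/2 with hb1
  obtain ⟨a, ha, ha1⟩ := exists_between (show max 0 (1-b1) < 1 by
    rw [max_lt_iff]; constructor <;> linarith)
  rw [max_lt_iff] at ha
  obtain ⟨B, hB, hle⟩ := JkH_norm_le w b1 (2*s₀.re) a (by linarith) (by linarith) ha.1 ha1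
  set U : Set ℂ := {s | b1 < s.re} ∩ {s | s.re < 2*s₀.re}
  have hU : IsOpen U := (isOpen_lt continuous_const Complex.continuous_re).inter
    (isOpen_lt Complex.continuous_re continuous_const)
  have hd : DifferentiableOn ℂ (fun s => ∑' m : ℕ+, Rb w s α m) U := by
    refine differentiableOn_tsum_of_summable_norm
      (u := fun m : ℕ+ => (B * α^(-a)) * (m:ℝ)^(-(b1+a))) ?_ ?_ hU ?_
    · exact (summable_pnat_rpow (b1+a) (by linarith)).mul_left _
    · intro m
      have h2 := (cpow_diff (m:ℝ) (pnat_pos_real m) (fun s => -s) (by fun_prop)).differentiableOn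
        (s := U)
      simp only [Complex.ofReal_natCast] at h2
      refine h2.mul ((JkH_diff w (m*α) (mul_pos (pnat_pos_real m) hα)).mono fun s hs => ?_)
      have : b1 < s.re := hs.1
      show 0 < s.re
      linarith
    · intro m s hs
      have h1 : b1 < s.re := hs.1
      have hm := pnat_pos_real m
      have hm1 : (1:ℝ) ≤ (m:ℝ) := by exact_mod_cast m.pos
      have h3 := hle (m*α) (mul_pos hm hα) s h1.le (le_of_lt hs.2)
      rw [Rb, norm_mul, ← Complex.ofReal_natCast, Complex.norm_cpow_eq_rpow_re_of_pos hm]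
      have h4 : (m:ℝ)^((-s).re) ≤ (m:ℝ)^(-b1) :=
        Real.rpow_le_rpow_of_exponent_le hm1 (by simp; linarith)
      calc (m:ℝ)^((-s).re) * ‖Jk w s (Hx (m*α))‖ ≤ (m:ℝ)^(-b1) * (B * (m*α)^(-a)) :=
            mul_le_mul h4 h3 (norm_nonneg _) (by positivity)
        _ = _ := by
          rw [Real.mul_rpow hm.le hα.le, neg_add, Real.rpow_add hm]; ring
  exact (hd.differentiableAt (hU.mem_nhds ⟨show b1 < s₀.re by linarith,
    show s₀.re < 2*s₀.re by linarith⟩)).differentiableWithinAt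

lemma tsumR_diff (w : ℂ) (α : ℝ) (hα : 0 < α) :
    DifferentiableOn ℂ (fun s => ∑' m : ℕ+, Rk w s (m*α)) {s : ℂ | 0 < s.re} := by
  simp only [Rk_Rb w _ α hα, tsum_mul_left]
  exact ((pre_diff w).differentiableOn.mul
    (cpow_diff α hα (fun s => -s) (by fun_prop)).differentiableOn).mul (Rb_diff w α hα)


lemma pnat_cpow_summable (s : ℂ) (hs : 1 < s.re) : Summable (fun m : ℕ+ => (m:ℂ)^(-s)) := by
  refine Summable.of_norm ((summable_pnat_rpow s.re hs).congr fun m => ?_)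
  rw [← Complex.ofReal_natCast, Complex.norm_cpow_eq_rpow_re_of_pos (pnat_pos_real m), Complex.neg_re]

lemma zeta_pnat (s : ℂ) (hs : 1 < s.re) : ∑' m : ℕ+, (m:ℂ)^(-s) = riemannZeta s := by
  rw [zeta_eq_tsum_one_div_nat_add_one_cpow hs, tsum_pnat_eq_tsum_succ (f := fun n : ℕ => (n:ℂ)^(-s))]
  refine tsum_congr fun n => ?_
  rw [Complex.cpow_neg]; push_cast; rw [one_div]

lemma dbl_summable (w s : ℂ) (hs : 2 < s.re) (α : ℝ) (hα : 0 < α) :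
    Summable (fun q : ℕ+ × ℕ+ => origK w s (q.2:ℝ) (q.1*α)) := by
  obtain ⟨p, h1, h2, h3⟩ := exists_p (s.re-1) (by linarith)
  refine Summable.of_norm_bounded (g := fun q : ℕ+ × ℕ+ =>
    ((∫ q, ‖Qk w s q‖ * Tt q ^ (-p) ∂mu3) / ‖Complex.Gamma (s/2)‖ * α^(2*p - s.re))
      * ((q.1:ℝ)^(-(s.re - 2*p)) * (q.2:ℝ)^(-(2*p)))) ?_ ?_
  · refine Summable.mul_left _ ?_
    exact (summable_pnat_rpow (s.re - 2*p) (by linarith)).mul_of_nonneg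
      (summable_pnat_rpow (2*p) (by linarith)) (fun m => by positivity) (fun m => by positivity)
  · rintro ⟨m, n⟩
    have hm := pnat_pos_real m
    refine (origK_norm_le w s (by linarith) (n:ℝ) (m*α) (pnat_pos_real n) (mul_pos hm hα) p
      (by linarith) h2 (by linarith)).trans (le_of_eq ?_)
    rw [Real.mul_rpow hm.le hα.le, neg_sub]
    ring

/-- The modular combination. -/
def Lm (w s : ℂ) (α : ℝ) : ℂ := (α:ℂ)^(s/2) * ((∑' m : ℕ+, Rk w s (m*α))
    - riemannZeta s * Afun w (s-1) / (2 * (α:ℂ)^s)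
    - riemannZeta (s-1) * Afun w (-(s-1)) / (α * (s-1)))

lemma re_ne (s : ℂ) (c : ℝ) (hs : c < s.re) : s ≠ (c:ℂ) := by
  intro h; rw [h] at hs; simp at hs

lemma tsumR_eq (w s : ℂ) (hw : w ≠ 0) (hs : 2 < s.re) (α : ℝ) (hα : 0 < α) :
    ∑' m : ℕ+, Rk w s (m*α) = Cc w s * ∑' m : ℕ+, ∑' n : ℕ+, origK w s (n:ℝ) (m*α)
      + Afun w (s-1) * (α:ℂ)^(-s) / 2 * riemannZeta s
      - Afun (I*w) (-(s-1)) * (α:ℂ)^(-(s-1)) / (s-1) * riemannZeta (s-1) := by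
  have hs' : 1 < (s-1).re := by simp; linarith
  have e : ∀ m : ℕ+, Rk w s (m*α) = Cc w s * ∑' n : ℕ+, origK w s (n:ℝ) (m*α)
      + Afun w (s-1) * (α:ℂ)^(-s) / 2 * (m:ℂ)^(-s)
      - Afun (I*w) (-(s-1)) * (α:ℂ)^(-(s-1)) / (s-1) * (m:ℂ)^(-(s-1)) := by
    intro m
    have hm := pnat_pos_real m
    rw [sum_origK w s hw (by linarith) _ (mul_pos hm hα), show -(s-1)-1 = -s by ring,
      Complex.ofReal_mul, Complex.mul_cpow_ofReal_nonneg hm.le hα.le,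
      Complex.mul_cpow_ofReal_nonneg hm.le hα.le, Complex.ofReal_natCast]
    ring
  have s1 := ((dbl_summable w s hs α hα).prod).mul_left (Cc w s)
  have s2 := (pnat_cpow_summable s (by linarith)).mul_left (Afun w (s-1) * (α:ℂ)^(-s) / 2)
  have s3 := (pnat_cpow_summable (s-1) hs').mul_left
    (Afun (I*w) (-(s-1)) * (α:ℂ)^(-(s-1)) / (s-1))
  rw [tsum_congr e, (s1.add s2).tsum_sub s3, s1.tsum_add s2, tsum_mul_left, tsum_mul_left,
    tsum_mul_left, zeta_pnat s (by linarith), zeta_pnat (s-1) hs']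

lemma Lm_eq (w s : ℂ) (hw : w ≠ 0) (hs : 2 < s.re) (α : ℝ) (hα : 0 < α) :
    Lm w s α = (α:ℂ)^(s/2) * (Cc w s * ∑' m : ℕ+, ∑' n : ℕ+, origK w s (n:ℝ) (m*α))
      - riemannZeta (s-1) / (s-1) * (Afun (I*w) (-(s-1)) * (α:ℂ)^(1 - s/2)
        + Afun w (-(s-1)) * (α:ℂ)^(-(1 - s/2))) := by
  have hα' : (α:ℂ) ≠ 0 := by exact_mod_cast hα.ne'
  have ha := cpow_pos_ne α hα s
  have hs1 : s - 1 ≠ 0 := sub_ne_zero.2 (by simpa using re_ne s 1 (by linarith))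
  rw [Lm, tsumR_eq w s hw hs α hα]
  have e1 : (α:ℂ)^(1 - s/2) = (α:ℂ)^(s/2) * (α:ℂ)^(-(s-1)) := by
    rw [← Complex.cpow_add _ _ hα']; congr 1; ring
  have e2 : (α:ℂ)^(-(1 - s/2)) = (α:ℂ)^(s/2) / α := by
    rw [show -(1 - s/2) = s/2 - 1 by ring, Complex.cpow_sub _ _ hα', Complex.cpow_one]
  rw [e1, e2, Complex.cpow_neg _ s]
  generalize (∑' m : ℕ+, ∑' n : ℕ+, origK w s (n:ℝ) (m*α)) = S
  field_simp
  ring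

lemma Lm_symm2 (w s : ℂ) (hw : w ≠ 0) (hs : 2 < s.re) (α β : ℝ) (hα : 0 < α) (hβ : 0 < β)
    (h : α * β = 1) : Lm w s α = Lm (I*w) s β := by
  have hI : I * w ≠ 0 := by simp [hw]
  rw [Lm_eq w s hw hs α hα, Lm_eq (I*w) s hI hs β hβ, Afun_I w _ hw]
  have hb : ∀ t : ℂ, (β:ℂ)^t = (α:ℂ)^(-t) := by
    intro t
    have hl : Real.log α + Real.log β = 0 := by
      rw [← Real.log_mul hα.ne' hβ.ne', h, Real.log_one]
    rw [cpe α hα, cpe β hβ, show Real.log β = -Real.log α by linarith]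
    congr 1; push_cast; ring
  have hC : Cc (I*w) s = - Cc w s := by
    rw [Cc, Cc, mul_pow, Complex.I_sq]
    rw [← div_neg]; congr 1; ring
  have hK : ∀ m n : ℕ+, origK (I*w) s (n:ℝ) (m*β) = -((α:ℂ)^s * origK w s (m:ℝ) (n*α)) := by
    intro m n
    have hm := pnat_pos_real m
    have hn := pnat_pos_real n
    rw [origK_swap w s (by linarith) _ _ hn (mul_pos hm hβ),
      show (m:ℝ)*β = β*m by ring, show (n:ℝ) = β*(n*α) by
        rw [show β*((n:ℝ)*α) = n*(α*β) by ring, h, mul_one],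
      origK_smul w s β m (n*α) hβ hm (mul_pos hn hα), hb, neg_neg,
      show β*((n:ℝ)*α) = n by rw [show β*((n:ℝ)*α) = n*(α*β) by ring, h, mul_one]]
  have hD : ∑' m : ℕ+, ∑' n : ℕ+, origK (I*w) s (n:ℝ) (m*β)
      = -((α:ℂ)^s * ∑' m : ℕ+, ∑' n : ℕ+, origK w s (n:ℝ) (m*α)) := by
    simp only [hK, tsum_neg, tsum_mul_left]
    congr 2
    exact (dbl_summable w s hs α hα).tsum_comm (f := fun m n : ℕ+ => origK w s (n:ℝ) (m*α))
  rw [hD, hC]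
  simp only [hb]
  have e : (α:ℂ)^(s/2) = (α:ℂ)^(-(s/2)) * (α:ℂ)^s := by
    rw [← Complex.cpow_add _ _ (by exact_mod_cast hα.ne')]; congr 1; ring
  rw [e, neg_neg]
  ring

lemma Lm_diff (w : ℂ) (hw : w ≠ 0) (α : ℝ) (hα : 0 < α) :
    DifferentiableOn ℂ (fun s => Lm w s α) ({s : ℂ | 0 < s.re} \ {1, 2}) := by
  set U : Set ℂ := ({s : ℂ | 0 < s.re} \ {1, 2}) with hUd
  have hU : U ⊆ {s : ℂ | 0 < s.re} := sdiff_subset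
  have hne : ∀ s ∈ U, s ≠ 1 ∧ s ≠ 2 := fun s hs => by
    have := hs.2
    simpa using this
  have hα' : (α:ℂ) ≠ 0 := by exact_mod_cast hα.ne'
  have z1 : DifferentiableOn ℂ riemannZeta U := fun s hs =>
    (differentiableAt_riemannZeta (hne s hs).1).differentiableWithinAt
  have z2 : DifferentiableOn ℂ (fun s => riemannZeta (s-1)) U := fun s hs => by
    have h1 : s - 1 ≠ 1 := fun h => (hne s hs).2 (by linear_combination h)
    have := (differentiableAt_riemannZeta h1).comp s (f := fun s : ℂ => s - 1) (by fun_prop)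
    exact this.differentiableWithinAt
  have c1 := (cpow_diff α hα (fun s => s/2) (by fun_prop)).differentiableOn (s := U)
  have c2 := (cpow_diff α hα (fun s => s) (by fun_prop)).differentiableOn (s := U)
  have d1 := (Afun_diff1 w hw).mono hU
  have d2 := (Afun_diff2 w hw).mono hU
  have d0 := (tsumR_diff w α hα).mono hU
  refine c1.mul ((d0.sub ((z1.mul d1).div (c2.const_mul 2) fun s _ => ?_)).sub
    ((z2.mul d2).div (by fun_prop) fun s hs => ?_))
  · exact mul_ne_zero two_ne_zero (cpow_pos_ne α hα s)
  · exact mul_ne_zero hα' (sub_ne_zero.2 (hne s hs).1)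

lemma Lm_symm (w s : ℂ) (hw : w ≠ 0) (hs : 0 < s.re) (hs1 : s ≠ 1) (hs2 : s ≠ 2)
    (α β : ℝ) (hα : 0 < α) (hβ : 0 < β) (h : α * β = 1) : Lm w s α = Lm (I*w) s β := by
  have hI : I * w ≠ 0 := by simp [hw]
  refine eqOn_halfplane {1, 2} (by simp) (fun s => Lm w s α) (fun s => Lm (I*w) s β) 2 (by norm_num)
    (Lm_diff w hw α hα) (Lm_diff (I*w) hI β hβ) (fun s hs _ => Lm_symm2 w s hw hs α β hα hβ h) s hs ?_
  simp [hs1, hs2]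

/-- Generalized modular relation (first equality of Theorem 2.1 / Theorems 1.1.5–1.1.6 of
Dixit–Kumar), stated for any analytic continuations `F`, `G` of `ζ_w(·, x+1)`,
`ζ_{iw}(·, x+1)`. -/
theorem generalized_modular_relation (w : ℂ) (hw : w ≠ 0)
    (z : ℂ) (hz1 : -1 < z.re) (hz2 : z.re < 1) (hz0 : z ≠ 0)
    (α β : ℝ) (hα : 0 < α) (hβ : 0 < β) (hαβ : α * β = 1)
    (F G : ℂ → ℝ → ℂ)
    (hF : ∀ x : ℝ, 0 < x → DifferentiableOn ℂ (fun s => F s x) {s : ℂ | -1 < s.re ∧ s ≠ 1})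
    (hFeq : ∀ x : ℝ, 0 < x → ∀ s : ℂ, 1 < s.re → F s x = zetaW w s (x + 1))
    (hG : ∀ x : ℝ, 0 < x → DifferentiableOn ℂ (fun s => G s x) {s : ℂ | -1 < s.re ∧ s ≠ 1})
    (hGeq : ∀ x : ℝ, 0 < x → ∀ s : ℂ, 1 < s.re → G s x = zetaW (I * w) s (x + 1)) :
    (α:ℂ) ^ ((z + 1) / 2) *
      ((∑' m : ℕ+, (F (z + 1) (m * α) + Afun w z * ((m * α : ℝ) : ℂ) ^ (-z - 1) / 2
          - Afun (I * w) (-z) * ((m * α : ℝ) : ℂ) ^ (-z) / z))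
        - riemannZeta (z + 1) * Afun w z / (2 * (α:ℂ) ^ (z + 1))
        - riemannZeta z * Afun w (-z) / (α * z))
  = (β:ℂ) ^ ((z + 1) / 2) *
      ((∑' m : ℕ+, (G (z + 1) (m * β) + Afun (I * w) z * ((m * β : ℝ) : ℂ) ^ (-z - 1) / 2
          - Afun w (-z) * ((m * β : ℝ) : ℂ) ^ (-z) / z))
        - riemannZeta (z + 1) * Afun (I * w) z / (2 * (β:ℂ) ^ (z + 1))
        - riemannZeta z * Afun (I * w) (-z) / (β * z)) := by
  have hI : I * w ≠ 0 := by simp [hw]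
  have hs : 0 < (z+1).re := by simp; linarith
  have hs1 : z + 1 ≠ 1 := by simpa using hz0
  have hs2 : z + 1 ≠ 2 := by
    intro h
    have : z.re = 1 := by
      rw [show z = 1 by linear_combination h, Complex.one_re]
    linarith
  have key := Lm_symm w (z+1) hw hs hs1 hs2 α β hα hβ hαβ
  have eF : ∀ m : ℕ+, F (z + 1) (m * α) + Afun w z * ((m * α : ℝ) : ℂ) ^ (-z - 1) / 2
      - Afun (I * w) (-z) * ((m * α : ℝ) : ℂ) ^ (-z) / z = Rk w (z+1) (m*α) := by
    intro m
    have hx := mul_pos (pnat_pos_real m) hα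
    have := phi_eq w hw _ hx (fun s => F s (m*α)) (hF _ hx) (hFeq _ hx) (z+1) hs hs1
    simpa only [add_sub_cancel_right] using this
  have eG : ∀ m : ℕ+, G (z + 1) (m * β) + Afun (I * w) z * ((m * β : ℝ) : ℂ) ^ (-z - 1) / 2
      - Afun w (-z) * ((m * β : ℝ) : ℂ) ^ (-z) / z = Rk (I*w) (z+1) (m*β) := by
    intro m
    have hx := mul_pos (pnat_pos_real m) hβ
    have := phi_eq (I*w) hI _ hx (fun s => G s (m*β)) (hG _ hx) (hGeq _ hx) (z+1) hs hs1
    simpa only [add_sub_cancel_right, Afun_I w _ hw] using this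
  simp only [Lm, add_sub_cancel_right] at key
  rw [tsum_congr eF, tsum_congr eG]
  exact key
end
end
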